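/- arXiv:math/0407101 — 5 statements merged into one kernel-verified Lean document; each statement's English description precedes it below -/
import Mathlib

section
/- For every k≥1 and all complex numbers t_1,…,t_k that are nonzero and pairwise distinct, Σ_{σ∈S_k} ∏_{u=1}^{k} 1/(t_{σ(u)} − t_{σ(u−1)}) = ∏_{i=1}^{k} 1/t_i, where t_{σ(0)} := 0. -/
open Finset in
/-- Partial fractions for `∏ i, 1 / (t i - a)`, a form of Lagrange interpolation of `1`. -/
theorem sum_one_div_sub_mul_prod_erase {ι K : Type*} [Fintype ι] [DecidableEq ι] [Nonempty ι]
    [Field K] {t : ι → K} {a : K} (ha : ∀ i, t i ≠ a) (ht : Function.Injective t) :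
    ∑ p, 1 / (t p - a) * ∏ i ∈ univ.erase p, 1 / (t i - t p) = ∏ i, 1 / (t i - a) := by
  have hsum := congrArg (Polynomial.eval a)
    (Lagrange.sum_basis (s := univ) (v := t) ht.injOn univ_nonempty)
  rw [Polynomial.eval_finsetSum, Polynomial.eval_one] at hsum
  refine Eq.trans ?_ ((congrArg ((∏ i, 1 / (t i - a)) * ·) hsum).trans (mul_one _))
  rw [mul_sum]
  refine sum_congr rfl fun p _ => ?_
  rw [← mul_prod_erase univ (fun i => 1 / (t i - a)) (mem_univ p), mul_assoc, Lagrange.basis,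
    Polynomial.eval_prod, ← prod_mul_distrib]
  congr 1
  refine prod_congr rfl fun i hi => ?_
  have h₁ : t i - a ≠ 0 := sub_ne_zero.2 (ha i)
  have h₂ : t i - t p ≠ 0 := sub_ne_zero.2 (ht.ne (ne_of_mem_erase hi))
  have h₃ : t p - t i ≠ 0 := sub_ne_zero.2 (ht.ne (ne_of_mem_erase hi).symm)
  simp only [Lagrange.basisDivisor, Polynomial.eval_mul, Polynomial.eval_C, Polynomial.eval_sub,
    Polynomial.eval_X]
  field_simp
  ring

theorem Fin.prod_swap_zero_succ {M : Type*} [CommMonoid M] {n : ℕ} (f : Fin (n + 1) → M)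
    (p : Fin (n + 1)) :
    ∏ x : Fin n, f (Equiv.swap 0 p x.succ) = ∏ i ∈ Finset.univ.erase p, f i := by
  refine Finset.prod_bij (fun x _ => Equiv.swap 0 p x.succ) ?_ ?_ ?_ fun _ _ => rfl
  · intro x _
    refine Finset.mem_erase.2 ⟨fun h => ?_, Finset.mem_univ _⟩
    rw [Equiv.swap_apply_eq_iff, Equiv.swap_apply_right] at h
    exact Fin.succ_ne_zero x h
  · intro x _ y _ h
    exact Fin.succ_injective n ((Equiv.swap 0 p).injective h)
  · intro i hi
    have h : Equiv.swap 0 p i ≠ 0 := fun h => by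
      rw [Equiv.swap_apply_eq_iff, Equiv.swap_apply_left] at h
      exact Finset.ne_of_mem_erase hi h
    obtain ⟨x, hx⟩ := Fin.exists_succ_eq.2 h
    exact ⟨x, Finset.mem_univ x, by rw [hx, Equiv.swap_apply_self]⟩

/-- The symmetrization of the chain function based at `a`. -/
theorem sum_perm_prod_one_div_sub_cons {K : Type*} [Field K] {n : ℕ} {t : Fin n → K} {a : K}
    (ha : ∀ i, t i ≠ a) (ht : Function.Injective t) :
    ∑ σ : Equiv.Perm (Fin n), ∏ u : Fin n,
      1 / (t (σ u) - (Fin.cons a (t ∘ σ) : Fin (n + 1) → K) u.castSucc) =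
    ∏ i, 1 / (t i - a) := by
  induction n generalizing a with
  | zero => simp
  | succ n ih =>
    rw [← sum_one_div_sub_mul_prod_erase ha ht, ← Equiv.Perm.decomposeFin.symm.sum_comp,
      Fintype.sum_prod_type]
    refine Finset.sum_congr rfl fun p _ => ?_
    have hinj : Function.Injective fun x : Fin n => t (Equiv.swap 0 p x.succ) :=
      ht.comp ((Equiv.swap 0 p).injective.comp (Fin.succ_injective n))
    have hne : ∀ x : Fin n, t (Equiv.swap 0 p x.succ) ≠ t p := fun x h => by
      have h := ht h
      rw [Equiv.swap_apply_eq_iff, Equiv.swap_apply_right] at h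
      exact Fin.succ_ne_zero x h
    rw [← Fin.prod_swap_zero_succ (fun i => 1 / (t i - t p)), ← ih hne hinj, Finset.mul_sum]
    refine Finset.sum_congr rfl fun e _ => ?_
    rw [Fin.prod_univ_succ]
    congr 1
    · simp
    · refine Finset.prod_congr rfl fun u _ => ?_
      rw [← Fin.succ_castSucc, Fin.cons_succ, Equiv.Perm.decomposeFin_symm_apply_succ]
      congr 2
      cases n with
      | zero => exact u.elim0
      | succ n =>
        cases u using Fin.cases with
        | zero => simp
        | succ u =>
          rw [← Fin.succ_castSucc, Fin.cons_succ, Function.comp_apply,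
            Equiv.Perm.decomposeFin_symm_apply_succ, Function.comp_apply]


/-- The coefficient form of the equality `Ω^{sl₂} = Ω̃^{sl₂}`: for `k ≥ 1` and nonzero,
pairwise distinct complex numbers `t₁, …, t_k`,
`Σ_{σ ∈ S_k} Π_{u=1}^{k} 1/(t_{σ(u)} − t_{σ(u−1)}) = Π_{i=1}^{k} 1/t_i`,
where `t_{σ(0)} := 0`. -/
theorem sl2_chain_symmetrization (k : ℕ) (hk : 1 ≤ k) (t : Fin k → ℂ)
    (h0 : ∀ i, t i ≠ 0) (hdist : Function.Injective t) :
    ∑ σ : Equiv.Perm (Fin k), ∏ u : Fin k,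
      1 / (t (σ u) -
        (if (u : ℕ) = 0 then 0
         else t (σ ⟨(u : ℕ) - 1, Nat.lt_of_le_of_lt (Nat.sub_le _ _) u.isLt⟩))) =
    ∏ i, 1 / t i := by
  have h := sum_perm_prod_one_div_sub_cons h0 hdist
  simp only [sub_zero] at h
  rw [← h]
  refine Finset.sum_congr rfl fun σ _ => Finset.prod_congr rfl fun u _ => ?_
  congr 2
  cases k with
  | zero => exact u.elim0
  | succ k =>
    cases u using Fin.cases with
    | zero => simp
    | succ u =>
      rw [← Fin.succ_castSucc, Fin.cons_succ, if_neg (by simp)]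
      rfl
end

section
/- Shuffle expansion of star products of canonical coefficient functions: let J_1 be a multi-index of content k and J_2 a multi-index of content l. Call a triple (S_1,S_2,J) a shuffle of (J_1,J_2) if S_1, S_2 are disjoint subsets of {1,…,|k|+|l|} with union {1,…,|k|+|l|}, #S_1=|k|, #S_2=|l|, and J:{1,…,|k|+|l|}→{1,…,r} satisfies J(i)=J_1(s_1(i)) for i∈S_1 and J(i)=J_2(s_2(i)) for i∈S_2, where s_1:S_1→{1,…,|k|} and s_2:S_2→{1,…,|l|} are the increasing bijections. Then ω_{J_1} * ω_{J_2} = Σ_{(S_1,S_2,J) shuffle of (J_1,J_2)} ω_J, as rational functions of the variables t^{(i)}_a (1≤i≤r, 1≤a≤k_i+l_i), at every point where both sides are defined. -/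
open Finset

noncomputable section

/-- The set of variables `t⁽ⁱ⁾_a`, `1 ≤ i ≤ r`, `1 ≤ a ≤ k i`. -/
abbrev SVars (r : ℕ) (k : Fin r → ℕ) := (i : Fin r) × Fin (k i)

/-- The field of rational functions over `ℂ` in the variables `t⁽ⁱ⁾_a`. -/
abbrev RF (r : ℕ) (k : Fin r → ℕ) := FractionRing (MvPolynomial (SVars r k) ℂ)

/-- The variable `t⁽ⁱ⁾_a` as a rational function. -/
def Xv (r : ℕ) (k : Fin r → ℕ) (v : SVars r k) : RF r k :=
  algebraMap (MvPolynomial (SVars r k) ℂ) (RF r k) (MvPolynomial.X v)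

/-- Relabelling of variables along an injective map induces a field embedding of the
fields of rational functions. -/
def liftRF {σ τ : Type} (e : σ → τ) (he : Function.Injective e) :
    FractionRing (MvPolynomial σ ℂ) →+* FractionRing (MvPolynomial τ ℂ) :=
  IsFractionRing.lift
    (g := (algebraMap (MvPolynomial τ ℂ) (FractionRing (MvPolynomial τ ℂ))).comp
      (MvPolynomial.rename e).toRingHom)
    (((IsFractionRing.injective (MvPolynomial τ ℂ)
          (FractionRing (MvPolynomial τ ℂ))).comp
        (MvPolynomial.rename_injective e he)))

/-- The permutation of the variables induced by `π ∈ G_k`. -/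
def permVar (r : ℕ) (k : Fin r → ℕ) (π : ∀ i, Equiv.Perm (Fin (k i))) :
    SVars r k ≃ SVars r k where
  toFun v := ⟨v.1, π v.1 v.2⟩
  invFun v := ⟨v.1, (π v.1).symm v.2⟩
  left_inv v := by cases v; simp
  right_inv v := by cases v; simp

/-- The action of `π ∈ G_k` on rational functions. -/
def permRF (r : ℕ) (k : Fin r → ℕ) (π : ∀ i, Equiv.Perm (Fin (k i))) :
    RF r k →+* RF r k :=
  liftRF (permVar r k π) (permVar r k π).injective

/-- The identification of the variables of the first factor of a star product with the
first `k i` variables of each color. -/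
def emb1 (r : ℕ) (k l : Fin r → ℕ) : SVars r k → SVars r (fun i => k i + l i) :=
  fun v => ⟨v.1, Fin.castAdd (l v.1) v.2⟩

/-- The identification of the variables of the second factor of a star product with the
last `l i` variables of each color. -/
def emb2 (r : ℕ) (k l : Fin r → ℕ) : SVars r l → SVars r (fun i => k i + l i) :=
  fun v => ⟨v.1, Fin.natAdd (k v.1) v.2⟩

lemma emb1_inj (r : ℕ) (k l : Fin r → ℕ) : Function.Injective (emb1 r k l) := by
  rintro ⟨i, a⟩ ⟨i', a'⟩ h
  have h1 : i = i' := congrArg Sigma.fst h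
  subst h1
  have h2 := (Sigma.ext_iff.mp h).2
  have h3 : ((Fin.castAdd (l i) a : ℕ)) = ((Fin.castAdd (l i) a' : ℕ)) :=
    (Fin.heq_ext_iff rfl).mp h2
  simp_all [Fin.ext_iff]

lemma emb2_inj (r : ℕ) (k l : Fin r → ℕ) : Function.Injective (emb2 r k l) := by
  rintro ⟨i, a⟩ ⟨i', a'⟩ h
  have h1 : i = i' := congrArg Sigma.fst h
  subst h1
  have h2 := (Sigma.ext_iff.mp h).2
  have h3 : ((Fin.natAdd (k i) a : ℕ)) = ((Fin.natAdd (k i) a' : ℕ)) :=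
    (Fin.heq_ext_iff rfl).mp h2
  simp_all [Fin.ext_iff]

/-- The star multiplication
`f*g = (1/∏_i k_i! l_i!)·Σ_{π ∈ G_{k+l}} π·(f(t⁽ⁱ⁾_1,…,t⁽ⁱ⁾_{k_i})·g(t⁽ⁱ⁾_{k_i+1},…,t⁽ⁱ⁾_{k_i+l_i}))`. -/
def starRF (r : ℕ) (k l : Fin r → ℕ) (f : RF r k) (g : RF r l) :
    RF r (fun i => k i + l i) :=
  ((∏ i, (k i).factorial * (l i).factorial : ℕ) : RF r (fun i => k i + l i))⁻¹ *
    ∑ π : ∀ i, Equiv.Perm (Fin (k i + l i)),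
      permRF r (fun i => k i + l i) π
        (liftRF (emb1 r k l) (emb1_inj r k l) f * liftRF (emb2 r k l) (emb2_inj r k l) g)

/-- `posCount J u` is the number of `v < u` with the same color as `u`; under the
identification of the paper, `t_u = t^{(J(u))}_{posCount J u + 1}`. -/
def posCount {r n : ℕ} (J : Fin n → Fin r) (u : Fin n) : ℕ :=
  (univ.filter fun v => J v = J u ∧ v < u).card

/-- The chain variable `t_u` (with `t_0 = 0`) as a rational function, after applying the
permutation `π ∈ G_k`. -/
def chainRF (r : ℕ) (k : Fin r → ℕ) {n : ℕ} (J : Fin n → Fin r)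
    (π : ∀ i, Equiv.Perm (Fin (k i))) : ℕ → RF r k
  | 0 => 0
  | (u + 1) =>
    if h : u < n then
      if h2 : posCount J ⟨u, h⟩ < k (J ⟨u, h⟩) then
        Xv r k ⟨J ⟨u, h⟩, π (J ⟨u, h⟩) ⟨posCount J ⟨u, h⟩, h2⟩⟩
      else 0
    else 0

/-- The canonical coefficient function
`ω_J = Σ_{π ∈ G_k} π·(∏_{u=1}^{n} 1/(t_u − t_{u−1}))` as a rational function. -/
def omegaRF (r : ℕ) (k : Fin r → ℕ) {n : ℕ} (J : Fin n → Fin r) : RF r k :=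
  ∑ π : ∀ i, Equiv.Perm (Fin (k i)),
    ∏ u ∈ range n, (chainRF r k J π (u + 1) - chainRF r k J π u)⁻¹

/-- `(S₁, S₂, J)` is a shuffle of `(J₁, J₂)`: `S₁, S₂` partition `{1,…,|k|+|l|}`, have
cardinalities `|k|` and `|l|`, and `J` restricts to `J₁ ∘ s₁` on `S₁` and to `J₂ ∘ s₂` on
`S₂`, where `s₁, s₂` are the increasing bijections `S₁ → {1,…,|k|}`, `S₂ → {1,…,|l|}`. -/
def IsShuffle (r : ℕ) (k l : Fin r → ℕ) (J1 : Fin (∑ i, k i) → Fin r)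
    (J2 : Fin (∑ i, l i) → Fin r)
    (S1 S2 : Finset (Fin ((∑ i, k i) + ∑ i, l i)))
    (J : Fin ((∑ i, k i) + ∑ i, l i) → Fin r) : Prop :=
  Disjoint S1 S2 ∧ S1 ∪ S2 = univ ∧
    ∃ (h1 : S1.card = ∑ i, k i) (h2 : S2.card = ∑ i, l i),
      (∀ u (hu : u ∈ S1), J u = J1 ((S1.orderIsoOfFin h1).symm ⟨u, hu⟩)) ∧
      (∀ u (hu : u ∈ S2), J u = J2 ((S2.orderIsoOfFin h2).symm ⟨u, hu⟩))

/-- The product `∏ (w u - w (u - 1))⁻¹` of a sequence `w` preceded by the base point `x`. -/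
def chainProd {K : Type*} [Field K] : ∀ {n : ℕ}, K → (Fin n → K) → K
  | 0, _, _ => 1
  | _ + 1, x, w => (w 0 - x)⁻¹ * chainProd (w 0) (Fin.tail w)

lemma chainProd_eq_prod {K : Type*} [Field K] {n : ℕ} (w : Fin n → K) (g : ℕ → K)
    (hg : ∀ u : Fin n, g (u + 1) = w u) :
    chainProd (g 0) w = ∏ u ∈ range n, (g (u + 1) - g u)⁻¹ := by
  induction n generalizing g with
  | zero => simp [chainProd]
  | succ n ih =>
    have h0 : g 1 = w 0 := hg 0
    rw [prod_range_succ', chainProd, ← h0, mul_comm]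
    congr 1
    exact ih (Fin.tail w) (fun u => g (u + 1)) fun u => hg u.succ

lemma map_chainProd {K L : Type*} [Field K] [Field L] (φ : K →+* L) {n : ℕ} (x : K)
    (w : Fin n → K) : φ (chainProd x w) = chainProd (φ x) (fun u => φ (w u)) := by
  induction n generalizing x with
  | zero => simp [chainProd]
  | succ n ih =>
    simp only [chainProd, map_mul, map_inv₀, map_sub, ih]
    rfl

lemma posCount_lt {r n : ℕ} (J : Fin n → Fin r) (u : Fin n) :
    posCount J u < #{v | J v = J u} := by
  refine card_lt_card ⟨fun v hv => ?_, fun h => ?_⟩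
  · simp_all
  · simpa using h (x := u) (by simp)

lemma posCount_strictMono {r n : ℕ} {J : Fin n → Fin r} {u v : Fin n} (hJ : J u = J v)
    (huv : u < v) : posCount J u < posCount J v := by
  refine card_lt_card ⟨fun w hw => ?_, fun h => ?_⟩
  · simp only [mem_filter, mem_univ, true_and] at hw ⊢
    exact ⟨hw.1.trans hJ, hw.2.trans huv⟩
  · simpa using h (x := u) (by simp [hJ, huv])

lemma posCount_injective {r n : ℕ} {J : Fin n → Fin r} {u v : Fin n} (hJ : J u = J v)
    (h : posCount J u = posCount J v) : u = v := by
  rcases lt_trichotomy u v with huv | huv | huv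
  · exact absurd h (posCount_strictMono hJ huv).ne
  · exact huv
  · exact absurd h (posCount_strictMono hJ.symm huv).ne'

lemma posCount_cons_zero {r n : ℕ} (s : Fin r) (p : Fin n → Fin r) :
    posCount (Fin.cons s p : Fin (n + 1) → Fin r) 0 = 0 := by
  simp [posCount]

lemma posCount_cons_succ {r n : ℕ} (s : Fin r) (p : Fin n → Fin r) (u : Fin n) :
    posCount (Fin.cons s p : Fin (n + 1) → Fin r) u.succ =
      posCount p u + if s = p u then 1 else 0 := by
  simp only [posCount, Fin.card_filter_univ_succ, Fin.cons_zero, Fin.cons_succ,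
    Fin.succ_lt_succ_iff, Fin.succ_pos, and_true]
  split_ifs <;> rfl

/-- The word in the letters `a 0, a 1, …` and `b 0, b 1, …` whose `u`-th letter is the next unused
letter of `a` if `p u = 0`, and of `b` otherwise. -/
def mergeSeq {α : Type*} {N : ℕ} (p : Fin N → Fin 2) (a b : ℕ → α) (u : Fin N) : α :=
  if p u = 0 then a (posCount p u) else b (posCount p u)

lemma tail_mergeSeq_cons_zero {α : Type*} {N : ℕ} (p : Fin N → Fin 2) (a b : ℕ → α) :
    Fin.tail (mergeSeq (Fin.cons 0 p : Fin (N + 1) → Fin 2) a b) =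
      mergeSeq p (fun i => a (i + 1)) b := by
  funext u
  simp only [Fin.tail, mergeSeq, posCount_cons_succ, Fin.cons_succ]
  by_cases h : p u = 0
  · simp [h]
  · simp [h, Ne.symm h]

lemma tail_mergeSeq_cons_one {α : Type*} {N : ℕ} (p : Fin N → Fin 2) (a b : ℕ → α) :
    Fin.tail (mergeSeq (Fin.cons 1 p : Fin (N + 1) → Fin 2) a b) =
      mergeSeq p a (fun i => b (i + 1)) := by
  funext u
  simp only [Fin.tail, mergeSeq, posCount_cons_succ, Fin.cons_succ]
  by_cases h : p u = 0
  · simp [h]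
  · simp [Fin.eq_one_of_ne_zero _ h]

lemma sum_cons_fin_two {M : Type*} [AddCommMonoid M] {N : ℕ} (g : (Fin (N + 1) → Fin 2) → M) :
    ∑ p, g p = ∑ p : Fin N → Fin 2, g (Fin.cons 0 p) + ∑ p : Fin N → Fin 2, g (Fin.cons 1 p) := by
  rw [← Equiv.sum_comp (Fin.consEquiv fun _ => Fin 2), Fintype.sum_prod_type, Fin.sum_univ_two]
  rfl

lemma chainProd_succ_nat {K : Type*} [Field K] (m : ℕ) (x : K) (a : ℕ → K) :
    chainProd x (fun i : Fin (m + 1) => a i) =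
      (a 0 - x)⁻¹ * chainProd (a 0) (fun i : Fin m => a (i + 1)) := rfl

/-- The shuffle identity for chain products with a common base point. -/
lemma sum_chainProd_mergeSeq {K : Type*} [Field K] (N m n : ℕ) (hN : m + n = N) (x : K)
    (a b : ℕ → K) (hax : ∀ i < m, a i ≠ x) (hbx : ∀ j < n, b j ≠ x)
    (haa : ∀ i j, i < j → j < m → a i ≠ a j) (hbb : ∀ i j, i < j → j < n → b i ≠ b j)
    (hab : ∀ i < m, ∀ j < n, a i ≠ b j) :
    ∑ p : Fin N → Fin 2 with #{u | p u = 0} = m, chainProd x (mergeSeq p a b) =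
      chainProd x (fun i : Fin m => a i) * chainProd x (fun j : Fin n => b j) := by
  induction N generalizing m n x a b with
  | zero =>
    obtain ⟨rfl, rfl⟩ : m = 0 ∧ n = 0 := by omega
    simp [chainProd]
  | succ N ih =>
    have h1 : ∀ p : Fin N → Fin 2,
        #{u | (Fin.cons 0 p : Fin (N + 1) → Fin 2) u = 0} = #{u | p u = 0} + 1 := fun p => by
      simp [Fin.card_filter_univ_succ]
    have h2 : ∀ p : Fin N → Fin 2,
        #{u | (Fin.cons 1 p : Fin (N + 1) → Fin 2) u = 0} = #{u | p u = 0} := fun p => by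
      simp [Fin.card_filter_univ_succ]
    have hz : ∀ p : Fin N → Fin 2,
        mergeSeq (Fin.cons 0 p : Fin (N + 1) → Fin 2) a b 0 = a 0 := fun p => by
      simp [mergeSeq, posCount_cons_zero]
    have ho : ∀ p : Fin N → Fin 2,
        mergeSeq (Fin.cons 1 p : Fin (N + 1) → Fin 2) a b 0 = b 0 := fun p => by
      simp [mergeSeq, posCount_cons_zero]
    rw [sum_filter, sum_cons_fin_two]
    simp only [h1, h2, chainProd, hz, ho, tail_mergeSeq_cons_zero, tail_mergeSeq_cons_one]
    simp only [← sum_filter, ← mul_sum]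
    rcases m with _ | m
    · obtain rfl : n = N + 1 := by omega
      have := ih 0 N (by omega) (b 0) a (fun i => b (i + 1)) (by simp)
        (fun j hj => (hbb 0 (j + 1) (by omega) (by omega)).symm) (by simp)
        (fun i j hij hj => hbb _ _ (by omega) (by omega)) (by simp)
      rw [this, chainProd_succ_nat]
      simp [chainProd]
    rcases n with _ | n
    · obtain rfl : m = N := by omega
      have := ih m 0 (by omega) (a 0) (fun i => a (i + 1)) b
        (fun j hj => (haa 0 (j + 1) (by omega) (by omega)).symm) (by simp)
        (fun i j hij hj => haa _ _ (by omega) (by omega)) (by simp) (by simp)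
      simp only [Nat.add_right_cancel_iff]
      rw [this, chainProd_succ_nat, filter_false_of_mem]
      · simp [chainProd]
      · intro p _ hp
        have := card_le_univ {u | p u = 0}
        simp at this
        omega
    · have ha := ih m (n + 1) (by omega) (a 0) (fun i => a (i + 1)) b
        (fun j hj => (haa 0 (j + 1) (by omega) (by omega)).symm)
        (fun j hj => (hab 0 (by omega) j hj).symm)
        (fun i j hij hj => haa _ _ (by omega) (by omega)) hbb
        (fun i hi j hj => hab _ (by omega) j hj)
      have hb := ih (m + 1) n (by omega) (b 0) a (fun i => b (i + 1))
        (fun j hj => hab j hj 0 (by omega))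
        (fun j hj => (hbb 0 (j + 1) (by omega) (by omega)).symm)
        haa (fun i j hij hj => hbb _ _ (by omega) (by omega))
        (fun i hi j hj => hab _ hi _ (by omega))
      simp only [Nat.add_right_cancel_iff]
      rw [ha, hb, chainProd_succ_nat m, chainProd_succ_nat n, chainProd_succ_nat m,
        chainProd_succ_nat n]
      have e1 : a 0 - x ≠ 0 := sub_ne_zero.2 (hax 0 (by omega))
      have e2 : b 0 - x ≠ 0 := sub_ne_zero.2 (hbx 0 (by omega))
      have e3 : a 0 - b 0 ≠ 0 := sub_ne_zero.2 (hab 0 (by omega) 0 (by omega))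
      rw [← neg_sub (a 0) (b 0)]
      field_simp
      ring

lemma liftRF_algebraMap_X {σ τ : Type} (e : σ → τ) (he : Function.Injective e) (v : σ) :
    liftRF e he (algebraMap (MvPolynomial σ ℂ) _ (MvPolynomial.X v)) =
      algebraMap (MvPolynomial τ ℂ) _ (MvPolynomial.X (e v)) := by
  simp [liftRF]

lemma permRF_Xv (r : ℕ) (k : Fin r → ℕ) (π : ∀ i, Equiv.Perm (Fin (k i))) (v : SVars r k) :
    permRF r k π (Xv r k v) = Xv r k (permVar r k π v) :=
  liftRF_algebraMap_X _ _ _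

lemma Xv_injective (r : ℕ) (k : Fin r → ℕ) : Function.Injective (Xv r k) :=
  (IsFractionRing.injective (MvPolynomial (SVars r k) ℂ) (RF r k)).comp
    MvPolynomial.X_injective

lemma Xv_ne_zero (r : ℕ) (k : Fin r → ℕ) (v : SVars r k) : Xv r k v ≠ 0 := by
  simp [Xv]

lemma card_filter_of_bijective {r n : ℕ} {k : Fin r → ℕ} {J : Fin n → Fin r}
    {c : Fin n → SVars r k} (hc : Function.Bijective c) (hcJ : ∀ u, (c u).1 = J u) (i : Fin r) :
    #{v | J v = i} = k i := by
  set e := Equiv.ofBijective c hc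
  rw [← Finset.card_fin (k i)]
  refine (card_bij (fun a _ => e.symm ⟨i, a⟩) (fun a _ => ?_) (fun a _ b _ h => ?_)
    fun v hv => ?_).symm
  · have : (e (e.symm ⟨i, a⟩)).1 = J (e.symm ⟨i, a⟩) := hcJ _
    simpa using this.symm
  · simpa using h
  · obtain rfl : (c v).1 = i := (hcJ v).trans (by simpa using hv)
    exact ⟨(c v).2, mem_univ _, e.symm_apply_apply v⟩

/-- The variables `t_1, …, t_n` attached to a multi-index of content `k`. -/
def chainVar {r n : ℕ} {k : Fin r → ℕ} (J : Fin n → Fin r) (hJ : ∀ i, #{v | J v = i} = k i)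
    (u : Fin n) : SVars r k :=
  ⟨J u, ⟨posCount J u, hJ (J u) ▸ posCount_lt J u⟩⟩

lemma chainVar_bijective {r n : ℕ} {k : Fin r → ℕ} (J : Fin n → Fin r)
    (hJ : ∀ i, #{v | J v = i} = k i) : Function.Bijective (chainVar J hJ) := by
  rw [Fintype.bijective_iff_injective_and_card]
  refine ⟨fun u v h => ?_, ?_⟩
  · obtain ⟨h1, h2⟩ := Sigma.ext_iff.1 h
    have h1' : J u = J v := h1
    refine posCount_injective h1' ?_
    exact (Fin.heq_ext_iff (congrArg k h1')).1 h2
  · simp only [Fintype.card_fin, Fintype.card_sigma, ← hJ]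
    simpa using card_eq_sum_card_fiberwise (f := J) (s := univ) (t := univ) (by simp)

lemma exists_permVar_eq {r : ℕ} {k : Fin r → ℕ} (e : Equiv.Perm (SVars r k))
    (he : ∀ v, (e v).1 = v.1) :
    ∃ ρ : ∀ i, Equiv.Perm (Fin (k i)), ∀ v, permVar r k ρ v = e v := by
  have h : ∀ i (a : Fin (k i)), ∃ b, e ⟨i, a⟩ = ⟨i, b⟩ := fun i a => by
    generalize hx : e ⟨i, a⟩ = x
    obtain ⟨j, b⟩ := x
    obtain rfl : j = i := by simpa [hx] using he ⟨i, a⟩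
    exact ⟨b, rfl⟩
  choose f hf using h
  have hinj : ∀ i, Function.Injective (f i) := fun i a b hab => by
    have : e ⟨i, a⟩ = e ⟨i, b⟩ := by rw [hf, hf, hab]
    simpa using this
  exact ⟨fun i => Equiv.ofBijective (f i) (Finite.injective_iff_bijective.1 (hinj i)),
    fun ⟨i, a⟩ => (hf i a).symm⟩

/-- The function `ω_J` may be computed from any enumeration of the variables with colors `J`. -/
lemma omegaRF_eq_sum_chainProd {r n : ℕ} {k : Fin r → ℕ} {J : Fin n → Fin r}
    {c : Fin n → SVars r k} (hc : Function.Bijective c) (hcJ : ∀ u, (c u).1 = J u) :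
    omegaRF r k J = ∑ π, chainProd 0 (fun u => Xv r k (permVar r k π (c u))) := by
  have hJ := card_filter_of_bijective hc hcJ
  obtain ⟨ρ, hρ⟩ := exists_permVar_eq
    ((Equiv.ofBijective c hc).symm.trans (Equiv.ofBijective _ (chainVar_bijective J hJ)))
    (fun v => by
      obtain ⟨u, rfl⟩ := hc.2 v
      simp [Equiv.ofBijective_symm_apply_apply, hcJ, chainVar])
  have hρc : ∀ u, permVar r k ρ (c u) = chainVar J hJ u := fun u => by
    simp [hρ, Equiv.ofBijective_symm_apply_apply]
  rw [← Equiv.sum_comp (Equiv.mulRight ρ), omegaRF]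
  refine Fintype.sum_congr _ _ fun π => ?_
  rw [← chainProd_eq_prod (fun u => Xv r k (permVar r k π (chainVar J hJ u))) (chainRF r k J π)]
  · simp only [← hρc]
    rfl
  · intro u
    have := (chainVar J hJ u).2.2
    simp only [chainVar] at this
    simp [chainRF, permVar, chainVar, this]

/-- The index form of `mergeSeq`. -/
def shuffleIndex {m n : ℕ} (p : Fin (m + n) → Fin 2) (hp : #{u | p u = 0} = m) (u : Fin (m + n)) :
    Fin m ⊕ Fin n :=
  if h : p u = 0 then Sum.inl ⟨posCount p u, (posCount_lt p u).trans_eq (by rw [h, hp])⟩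
  else Sum.inr ⟨posCount p u, (posCount_lt p u).trans_eq (by
    have := card_filter_add_card_filter_not (s := (univ : Finset (Fin (m + n)))) (fun v => p v = 0)
    have h1 : ∀ v, p v = p u ↔ ¬ p v = 0 := fun v => by omega
    simp only [h1]
    simp at this
    omega)⟩

lemma shuffleIndex_of_eq_zero {m n : ℕ} (p : Fin (m + n) → Fin 2) (hp : #{u | p u = 0} = m)
    {u : Fin (m + n)} (h : p u = 0) : ∃ a : Fin m, shuffleIndex p hp u = Sum.inl a ∧
      (a : ℕ) = posCount p u :=
  ⟨_, dif_pos h, rfl⟩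

lemma shuffleIndex_of_ne_zero {m n : ℕ} (p : Fin (m + n) → Fin 2) (hp : #{u | p u = 0} = m)
    {u : Fin (m + n)} (h : p u ≠ 0) : ∃ b : Fin n, shuffleIndex p hp u = Sum.inr b ∧
      (b : ℕ) = posCount p u :=
  ⟨_, dif_neg h, rfl⟩

lemma shuffleIndex_bijective {m n : ℕ} (p : Fin (m + n) → Fin 2) (hp : #{u | p u = 0} = m) :
    Function.Bijective (shuffleIndex p hp) := by
  rw [Fintype.bijective_iff_injective_and_card]
  refine ⟨fun u v h => ?_, by simp⟩
  by_cases hu : p u = 0 <;> by_cases hv : p v = 0 <;> simp [shuffleIndex, hu, hv] at h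
  · exact posCount_injective (hu.trans hv.symm) h
  · exact posCount_injective (by omega) h

lemma sum_chainProd_shuffleIndex {K : Type*} [Field K] {m n : ℕ} (f : Fin m ⊕ Fin n → K)
    (hf : Function.Injective f) (hf0 : ∀ s, f s ≠ 0) :
    ∑ p : {p : Fin (m + n) → Fin 2 // #{u | p u = 0} = m},
        chainProd 0 (fun u => f (shuffleIndex p.1 p.2 u)) =
      chainProd 0 (fun i => f (Sum.inl i)) * chainProd 0 (fun j => f (Sum.inr j)) := by
  set a : ℕ → K := fun i => if h : i < m then f (Sum.inl ⟨i, h⟩) else 0 with ha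
  set b : ℕ → K := fun j => if h : j < n then f (Sum.inr ⟨j, h⟩) else 0 with hb
  have key := sum_chainProd_mergeSeq (m + n) m n rfl 0 a b
    (fun i hi => by simp [ha, hi, hf0]) (fun i hi => by simp [hb, hi, hf0])
    (fun i j hij hj => by simp [ha, hj, hij.trans hj, hf.eq_iff, hij.ne])
    (fun i j hij hj => by simp [hb, hj, hij.trans hj, hf.eq_iff, hij.ne])
    (fun i hi j hj => by simp [ha, hb, hi, hj, hf.eq_iff])
  simp only [ha, hb, Fin.is_lt, dite_true, Fin.eta] at key
  rw [← key, ← Finset.sum_subtype_eq_sum_filter, subtype_univ]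
  refine Fintype.sum_congr _ _ fun p => ?_
  congr 1
  funext u
  by_cases h : p.1 u = 0
  · obtain ⟨c, hc, hcp⟩ := shuffleIndex_of_eq_zero p.1 p.2 h
    simp [mergeSeq, h, hc, ← hcp]
  · obtain ⟨c, hc, hcp⟩ := shuffleIndex_of_ne_zero p.1 p.2 h
    simp [mergeSeq, h, hc, ← hcp]

lemma orderIsoOfFin_symm_val {α : Type*} [LinearOrder α] (s : Finset α) {n : ℕ} (h : #s = n)
    (u : α) (hu : u ∈ s) : ((s.orderIsoOfFin h).symm ⟨u, hu⟩ : ℕ) = #{v ∈ s | v < u} := by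
  rw [← Fin.card_Iio]
  refine card_bij (fun a _ => (s.orderIsoOfFin h a : α)) (fun a ha => ?_) (fun a _ b _ hab => ?_)
    fun v hv => ?_
  · have := (OrderIso.lt_symm_apply _).1 (mem_Iio.1 ha)
    exact mem_filter.2 ⟨(s.orderIsoOfFin h a).2, this⟩
  · exact (s.orderIsoOfFin h).injective (Subtype.ext hab)
  · obtain ⟨hvs, hvu⟩ := mem_filter.1 hv
    refine ⟨(s.orderIsoOfFin h).symm ⟨v, hvs⟩, mem_Iio.2 ?_, by simp⟩
    exact (OrderIso.lt_iff_lt _).2 hvu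

lemma elim_shuffleIndex_of_eq_zero {β : Type*} {m n : ℕ} (J1 : Fin m → β) (J2 : Fin n → β)
    (p : Fin (m + n) → Fin 2) (hp : #{u | p u = 0} = m) (u : Fin (m + n))
    (hu : u ∈ ({u | p u = 0} : Finset _)) :
    Sum.elim J1 J2 (shuffleIndex p hp u) =
      J1 ((({u | p u = 0} : Finset _).orderIsoOfFin hp).symm ⟨u, hu⟩) := by
  have h : p u = 0 := by simpa using hu
  obtain ⟨a, ha, hap⟩ := shuffleIndex_of_eq_zero p hp h
  rw [ha, Sum.elim_inl]
  congr 1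
  rw [Fin.ext_iff, hap, orderIsoOfFin_symm_val, filter_filter, posCount, h]

lemma elim_shuffleIndex_of_ne_zero {β : Type*} {m n : ℕ} (J1 : Fin m → β) (J2 : Fin n → β)
    (p : Fin (m + n) → Fin 2) (hp : #{u | p u = 0} = m) (hp' : #{u | p u ≠ 0} = n)
    (u : Fin (m + n)) (hu : u ∈ ({u | p u ≠ 0} : Finset _)) :
    Sum.elim J1 J2 (shuffleIndex p hp u) =
      J2 ((({u | p u ≠ 0} : Finset _).orderIsoOfFin hp').symm ⟨u, hu⟩) := by
  have h : p u ≠ 0 := by simpa using hu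
  obtain ⟨a, ha, hap⟩ := shuffleIndex_of_ne_zero p hp h
  have h1 : ∀ v, p v = p u ↔ p v ≠ 0 := fun v => by omega
  rw [ha, Sum.elim_inr]
  congr 1
  rw [Fin.ext_iff, hap, orderIsoOfFin_symm_val, filter_filter, posCount]
  simp only [h1]

lemma isShuffle_iff {r : ℕ} {k l : Fin r → ℕ} {J1 : Fin (∑ i, k i) → Fin r}
    {J2 : Fin (∑ i, l i) → Fin r} {S1 S2 : Finset (Fin ((∑ i, k i) + ∑ i, l i))}
    {J : Fin ((∑ i, k i) + ∑ i, l i) → Fin r} :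
    IsShuffle r k l J1 J2 S1 S2 J ↔
      ∃ (p : Fin ((∑ i, k i) + ∑ i, l i) → Fin 2) (hp : #{u | p u = 0} = ∑ i, k i),
        S1 = ({u | p u = 0} : Finset _) ∧ S2 = ({u | p u ≠ 0} : Finset _) ∧
          J = Sum.elim J1 J2 ∘ shuffleIndex p hp := by
  constructor
  · rintro ⟨hd, hu, h1, h2, hJ1, hJ2⟩
    set p : Fin ((∑ i, k i) + ∑ i, l i) → Fin 2 := fun u => if u ∈ S1 then 0 else 1 with hpdef
    have e1 : S1 = ({u | p u = 0} : Finset _) := by ext u; simp [hpdef]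
    have e2 : S2 = ({u | p u ≠ 0} : Finset _) := by
      ext u
      have h3 : u ∈ S1 ∪ S2 := hu ▸ mem_univ u
      have h4 : u ∈ S1 → u ∉ S2 := fun h => disjoint_left.1 hd h
      simp only [mem_union] at h3
      simp [hpdef]
      tauto
    clear_value p
    subst e1 e2
    refine ⟨p, h1, rfl, rfl, funext fun u => ?_⟩
    by_cases h : p u = 0
    · rw [hJ1 u (by simpa using h)]
      exact (elim_shuffleIndex_of_eq_zero J1 J2 p h1 u _).symm
    · rw [hJ2 u (by simpa using h)]
      exact (elim_shuffleIndex_of_ne_zero J1 J2 p h1 h2 u _).symm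
  · rintro ⟨p, hp, rfl, rfl, rfl⟩
    have hp' : #{u | p u ≠ 0} = ∑ i, l i := by
      have : #{u | p u = 0} + #{u | p u ≠ 0} = _ := card_filter_add_card_filter_not (p · = 0)
      rw [hp, card_univ, Fintype.card_fin] at this
      omega
    exact ⟨disjoint_filter_filter_not _ _ _, filter_union_filter_not_eq _ _, hp, hp',
      elim_shuffleIndex_of_eq_zero J1 J2 p hp, elim_shuffleIndex_of_ne_zero J1 J2 p hp hp'⟩

lemma finsum_isShuffle {r : ℕ} {k l : Fin r → ℕ} (J1 : Fin (∑ i, k i) → Fin r)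
    (J2 : Fin (∑ i, l i) → Fin r) {M : Type*} [AddCommMonoid M]
    (g : (Fin ((∑ i, k i) + ∑ i, l i) → Fin r) → M) :
    ∑ᶠ x : {x : Finset (Fin ((∑ i, k i) + ∑ i, l i)) ×
            Finset (Fin ((∑ i, k i) + ∑ i, l i)) ×
            (Fin ((∑ i, k i) + ∑ i, l i) → Fin r) //
          IsShuffle r k l J1 J2 x.1 x.2.1 x.2.2}, g x.val.2.2 =
      ∑ p : {p : Fin ((∑ i, k i) + ∑ i, l i) → Fin 2 // #{u | p u = 0} = ∑ i, k i},
        g (Sum.elim J1 J2 ∘ shuffleIndex p.1 p.2) := by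
  refine Eq.trans (Eq.symm ?_) (finsum_eq_sum_of_fintype _)
  refine finsum_eq_of_bijective (fun p => ⟨⟨_, _, _⟩, isShuffle_iff.2 ⟨p.1, p.2, rfl, rfl, rfl⟩⟩)
    ⟨fun p q h => ?_, ?_⟩ fun p => rfl
  · have h1 : ({u | p.1 u = 0} : Finset _) = ({u | q.1 u = 0} : Finset _) :=
      congrArg (fun x => x.1.1) h
    refine Subtype.ext (funext fun u => ?_)
    have h2 := Finset.ext_iff.1 h1 u
    simp only [mem_filter, mem_univ, true_and] at h2
    omega
  · rintro ⟨⟨S1, S2, J⟩, h⟩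
    obtain ⟨p, hp, rfl, rfl, rfl⟩ := isShuffle_iff.1 h
    exact ⟨⟨p, hp⟩, rfl⟩

lemma emb_elim_bijective (r : ℕ) (k l : Fin r → ℕ) :
    Function.Bijective (Sum.elim (emb1 r k l) (emb2 r k l)) := by
  rw [Fintype.bijective_iff_injective_and_card]
  refine ⟨(emb1_inj r k l).sumElim (emb2_inj r k l) ?_, by simp [sum_add_distrib]⟩
  rintro ⟨i, a⟩ ⟨j, b⟩ h
  obtain ⟨h1, h2⟩ := Sigma.ext_iff.1 h
  obtain rfl : i = j := h1
  have h3 := (Fin.heq_ext_iff rfl).1 h2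
  simp only [emb1, emb2, Fin.val_castAdd, Fin.val_natAdd] at h3
  omega

/-- The symmetrized product of the chain products of two enumerations of variables. -/
lemma sum_permRF_mul_chainProd {r : ℕ} {k l : Fin r → ℕ} {J1 : Fin (∑ i, k i) → Fin r}
    {J2 : Fin (∑ i, l i) → Fin r} {c : Fin (∑ i, k i) → SVars r k}
    (hc : Function.Bijective c) (hcJ : ∀ u, (c u).1 = J1 u)
    {d : Fin (∑ i, l i) → SVars r l} (hd : Function.Bijective d) (hdJ : ∀ u, (d u).1 = J2 u) :
    ∑ π, permRF r (fun i => k i + l i) π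
        (liftRF (emb1 r k l) (emb1_inj r k l) (chainProd 0 (fun u => Xv r k (c u))) *
          liftRF (emb2 r k l) (emb2_inj r k l) (chainProd 0 (fun u => Xv r l (d u)))) =
      ∑ p : {p : Fin ((∑ i, k i) + ∑ i, l i) → Fin 2 // #{u | p u = 0} = ∑ i, k i},
        omegaRF r (fun i => k i + l i) (Sum.elim J1 J2 ∘ shuffleIndex p.1 p.2) := by
  set f : Fin (∑ i, k i) ⊕ Fin (∑ i, l i) → SVars r (fun i => k i + l i) :=
    Sum.elim (emb1 r k l) (emb2 r k l) ∘ Sum.map c d with hfdef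
  have hf : Function.Bijective f :=
    (emb_elim_bijective r k l).comp (Sum.map_bijective.2 ⟨hc, hd⟩)
  have hfJ : ∀ s, (f s).1 = Sum.elim J1 J2 s := by
    rintro (u | u)
    · exact hcJ u
    · exact hdJ u
  have hω := fun p : {p : Fin ((∑ i, k i) + ∑ i, l i) → Fin 2 // #{u | p u = 0} = ∑ i, k i} =>
    omegaRF_eq_sum_chainProd (hf.comp (shuffleIndex_bijective p.1 p.2))
      (J := Sum.elim J1 J2 ∘ shuffleIndex p.1 p.2) fun u => hfJ _
  simp only [hω]
  rw [sum_comm]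
  refine Fintype.sum_congr _ _ fun π => ?_
  refine Eq.trans ?_ (sum_chainProd_shuffleIndex
    (fun s => Xv r (fun i => k i + l i) (permVar r (fun i => k i + l i) π (f s)))
    ((Xv_injective _ _).comp ((permVar _ _ π).injective.comp hf.1))
    fun s => Xv_ne_zero _ _ _).symm
  rw [map_mul, map_chainProd, map_chainProd, map_chainProd, map_chainProd]
  simp only [map_zero]
  congr 2
  · funext u
    exact (congrArg _ (liftRF_algebraMap_X _ _ _)).trans (permRF_Xv _ _ _ _)
  · funext u
    exact (congrArg _ (liftRF_algebraMap_X _ _ _)).trans (permRF_Xv _ _ _ _)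

/-- shuffle expansion of star products of canonical coefficient functions:
for multi-indices `J₁` of content `k` and `J₂` of content `l`,
`ω_{J₁} * ω_{J₂} = Σ_{(S₁,S₂,J) shuffle of (J₁,J₂)} ω_J` as rational functions of the
variables `t⁽ⁱ⁾_a` (`1 ≤ a ≤ k i + l i`). -/
theorem shuffle_expansion (r : ℕ) (k l : Fin r → ℕ)
    (J1 : Fin (∑ i, k i) → Fin r) (J2 : Fin (∑ i, l i) → Fin r)
    (hJ1 : ∀ i : Fin r, (univ.filter fun v => J1 v = i).card = k i)
    (hJ2 : ∀ i : Fin r, (univ.filter fun v => J2 v = i).card = l i) :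
    starRF r k l (omegaRF r k J1) (omegaRF r l J2) =
      ∑ᶠ x : {x : Finset (Fin ((∑ i, k i) + ∑ i, l i)) ×
            Finset (Fin ((∑ i, k i) + ∑ i, l i)) ×
            (Fin ((∑ i, k i) + ∑ i, l i) → Fin r) //
          IsShuffle r k l J1 J2 x.1 x.2.1 x.2.2},
        omegaRF r (fun i => k i + l i) x.val.2.2 := by
  have hc := chainVar_bijective J1 hJ1
  have hd := chainVar_bijective J2 hJ2
  have key := fun (σ : ∀ i, Equiv.Perm (Fin (k i))) (τ : ∀ i, Equiv.Perm (Fin (l i))) =>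
    sum_permRF_mul_chainProd (J1 := J1) (J2 := J2)
      (((permVar r k σ).bijective).comp hc) (fun u => rfl)
      (((permVar r l τ).bijective).comp hd) (fun u => rfl)
  have : CharZero (RF r fun i => k i + l i) :=
    charZero_of_injective_algebraMap (IsFractionRing.injective
      (MvPolynomial (SVars r fun i => k i + l i) ℂ) (RF r fun i => k i + l i))
  rw [finsum_isShuffle, starRF, omegaRF_eq_sum_chainProd (J := J1) hc (fun u => rfl),
    omegaRF_eq_sum_chainProd (J := J2) hd (fun u => rfl)]
  simp only [map_sum, sum_mul_sum]
  rw [sum_comm]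
  simp only [sum_comm (s := (univ : Finset (∀ i, Equiv.Perm (Fin (k i + l i)))))]
  simp only [Function.comp_def] at key
  simp only [key]
  rw [inv_mul_eq_iff_eq_mul₀ (by
    exact_mod_cast (prod_pos fun i _ => Nat.mul_pos (Nat.factorial_pos _)
      (Nat.factorial_pos _)).ne')]
  simp only [sum_const, card_univ, Fintype.card_pi, Fintype.card_perm, Fintype.card_fin,
    nsmul_eq_mul, prod_mul_distrib, Function.comp_def]
  push_cast
  ring

end
end

section
/- Residue of the canonical coefficient function, vanishing case: let k∈ℕ^r, let i satisfy k_i≥1, and let J be a multi-index of content k with J(1)≠i. Then, for every choice of the variables t^{(i')}_a other than x := t^{(i)}_{k_i} lying outside a finite union of affine hyperplanes, the rational function x ↦ ω_J is regular at x=0; in particular lim_{x→0} x·ω_J = 0. -/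
open Finset Filter Topology

/-- The value of the chain variable `t_u` (with `t_0 = 0`), after applying the permutation
`π ∈ G_k` and evaluating at the point `t`. -/
def chainVal (r : ℕ) (k : Fin r → ℕ) {n : ℕ} (J : Fin n → Fin r)
    (π : ∀ i, Equiv.Perm (Fin (k i))) (t : SVars r k → ℂ) : ℕ → ℂ
  | 0 => 0
  | (u + 1) =>
    if h : u < n then
      if h2 : posCount J ⟨u, h⟩ < k (J ⟨u, h⟩) then
        t ⟨J ⟨u, h⟩, π (J ⟨u, h⟩) ⟨posCount J ⟨u, h⟩, h2⟩⟩
      else 0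
    else 0

/-- The canonical coefficient function
`ω_J = Σ_{π ∈ G_k} π·(∏_{u=1}^{n} 1/(t_u − t_{u−1}))`, evaluated at a point. -/
noncomputable def omegaPt (r : ℕ) (k : Fin r → ℕ) {n : ℕ} (J : Fin n → Fin r)
    (t : SVars r k → ℂ) : ℂ :=
  ∑ π : ∀ i, Equiv.Perm (Fin (k i)),
    ∏ u ∈ range n,
      (chainVal r k J π t (u + 1) - chainVal r k J π t u)⁻¹

/-- Extend an assignment of all variables other than `v0` by assigning `x` to `v0`. -/
noncomputable def extendAt (r : ℕ) (k : Fin r → ℕ) (v0 : SVars r k)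
    (s : {v : SVars r k // v ≠ v0} → ℂ) (x : ℂ) : SVars r k → ℂ :=
  fun v => if h : v = v0 then x else s ⟨v, h⟩

/-- View a variable for the smaller content `k'` as one of the variables `≠ v0` for the
content `k`. -/
def restrictVar (r : ℕ) (k k' : Fin r → ℕ) (hk : ∀ i, k' i ≤ k i) (v0 : SVars r k)
    (hv0 : k' v0.1 ≤ (v0.2 : ℕ)) (v : SVars r k') : {w : SVars r k // w ≠ v0} :=
  ⟨⟨v.1, ⟨(v.2 : ℕ), lt_of_lt_of_le v.2.isLt (hk v.1)⟩⟩, by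
    intro hEq
    have h1 : v.1 = v0.1 := congrArg Sigma.fst hEq
    have h2 := (Sigma.ext_iff.mp hEq).2
    have h3 : ((v.2 : ℕ)) = (v0.2 : ℕ) :=
      (Fin.heq_ext_iff (congrArg k h1)).mp h2
    have h4 : (v.2 : ℕ) < k' v.1 := v.2.isLt
    have h5 : k' v.1 = k' v0.1 := congrArg k' h1
    omega⟩

/-- The distinguished variable `t⁽ⁱ⁾_{k_i}` (the last lower index of color `i`). -/
def lastVar (r : ℕ) (k : Fin r → ℕ) (i : Fin r) (hki : 1 ≤ k i) : SVars r k :=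
  ⟨i, ⟨k i - 1, by omega⟩⟩

theorem posCount_lt_card {r n : ℕ} (J : Fin n → Fin r) (u : Fin n) :
    posCount J u < (univ.filter fun v => J v = J u).card := by
  refine Finset.card_lt_card (Finset.ssubset_iff_of_subset ?_ |>.mpr ⟨u, ?_, ?_⟩)
  · intro v hv
    simp only [mem_filter, mem_univ, true_and] at hv ⊢
    exact hv.1
  · simp
  · simp

theorem exists_chainVal_succ_eq {r : ℕ} {k : Fin r → ℕ} {n : ℕ} {J : Fin n → Fin r}
    (hJ : ∀ j : Fin r, (univ.filter fun v => J v = j).card = k j)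
    (π : ∀ i, Equiv.Perm (Fin (k i))) {u : ℕ} (hu : u < n) :
    ∃ a : Fin (k (J ⟨u, hu⟩)), ∀ t : SVars r k → ℂ,
      chainVal r k J π t (u + 1) = t ⟨J ⟨u, hu⟩, a⟩ := by
  have h := (posCount_lt_card J ⟨u, hu⟩).trans_eq (hJ _)
  exact ⟨π _ ⟨_, h⟩, fun t => by simp only [chainVal, dif_pos hu, dif_pos h]⟩

/-- A difference of two coordinates has a convergent inverse as the distinguished coordinate
tends to `0`, provided all the other coordinates are nonzero. -/
theorem exists_tendsto_inv_extendAt_sub {r : ℕ} {k : Fin r → ℕ} {v₀ : SVars r k}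
    {s : {v : SVars r k // v ≠ v₀} → ℂ} (hs : ∀ v, s v ≠ 0) (v w : SVars r k) :
    ∃ c : ℂ, Tendsto (fun x => (extendAt r k v₀ s x v - extendAt r k v₀ s x w)⁻¹)
      (𝓝[≠] 0) (𝓝 c) := by
  have hid : Tendsto (fun x : ℂ => x) (𝓝[≠] 0) (𝓝 0) := tendsto_id.mono_left nhdsWithin_le_nhds
  by_cases hv : v = v₀ <;> by_cases hw : w = v₀ <;> simp only [extendAt, hv, hw, ↓reduceDIte]
  · exact ⟨0, by simp⟩
  · exact ⟨_, (hid.sub_const _).inv₀ (by simpa using hs ⟨w, hw⟩)⟩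
  · exact ⟨_, (hid.const_sub _).inv₀ (by simpa using hs ⟨v, hv⟩)⟩
  · exact ⟨_, tendsto_const_nhds⟩

theorem exists_tendsto_omegaPt_extendAt {r : ℕ} {k : Fin r → ℕ} {n : ℕ} {J : Fin n → Fin r}
    (hJ : ∀ j : Fin r, (univ.filter fun v => J v = j).card = k j) {v₀ : SVars r k}
    (hJ0 : ∀ h : 0 < n, J ⟨0, h⟩ ≠ v₀.1)
    {s : {v : SVars r k // v ≠ v₀} → ℂ} (hs : ∀ v, s v ≠ 0) :
    ∃ c : ℂ, Tendsto (fun x => omegaPt r k J (extendAt r k v₀ s x)) (𝓝[≠] 0) (𝓝 c) := by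
  have key : ∀ (π : ∀ i, Equiv.Perm (Fin (k i))) (u : ℕ), ∃ c : ℂ, u ∈ range n →
      Tendsto (fun x => (chainVal r k J π (extendAt r k v₀ s x) (u + 1) -
        chainVal r k J π (extendAt r k v₀ s x) u)⁻¹) (𝓝[≠] 0) (𝓝 c) := by
    intro π u
    by_cases hu : u < n
    · obtain ⟨a, ha⟩ := exists_chainVal_succ_eq hJ π hu
      cases u with
      | zero =>
        have hne : (⟨J ⟨0, hu⟩, a⟩ : SVars r k) ≠ v₀ := fun h => hJ0 hu (congrArg Sigma.fst h)
        refine ⟨(s ⟨_, hne⟩)⁻¹, fun _ => ?_⟩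
        have hx : ∀ x, extendAt r k v₀ s x ⟨_, a⟩ = s ⟨_, hne⟩ := fun x => dif_neg hne
        simpa only [ha, hx, chainVal.eq_1, sub_zero] using tendsto_const_nhds
      | succ m =>
        obtain ⟨b, hb⟩ := exists_chainVal_succ_eq hJ π (Nat.lt_of_succ_lt hu)
        obtain ⟨c, hc⟩ := exists_tendsto_inv_extendAt_sub hs
          ⟨J ⟨m + 1, hu⟩, a⟩ ⟨J ⟨m, Nat.lt_of_succ_lt hu⟩, b⟩
        refine ⟨c, fun _ => ?_⟩
        simpa only [ha, hb] using hc
    · exact ⟨0, fun h => absurd (mem_range.mp h) hu⟩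
  choose c hc using key
  exact ⟨_, tendsto_finsetSum _ fun π _ => tendsto_finsetProd _ fun u hu => hc π u hu⟩

/-- residue of the canonical coefficient function, vanishing case.
If `J` is a multi-index of content `k` with `J(1) ≠ i`, then for every choice of the
variables other than `x := t⁽ⁱ⁾_{k_i}` outside a finite union of affine hyperplanes,
`x ↦ ω_J` is regular at `x = 0` (it has a finite limit there); in particular
`lim_{x→0} x·ω_J = 0`. -/
theorem residue_omegaJ_vanishing (r : ℕ) (k : Fin r → ℕ) (i : Fin r) (hki : 1 ≤ k i)
    (J : Fin (∑ u, k u) → Fin r)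
    (hJ : ∀ i' : Fin r, (univ.filter fun v => J v = i').card = k i')
    (hJ0 : J ⟨0, Nat.lt_of_lt_of_le hki
        (Finset.single_le_sum (f := k) (fun _ _ => Nat.zero_le _) (mem_univ i))⟩ ≠ i) :
    ∃ N : Finset ((({v : SVars r k // v ≠ lastVar r k i hki} → ℂ) →ₗ[ℂ] ℂ) × ℂ),
      (∀ q ∈ N, q.1 ≠ 0) ∧
      ∀ s : {v : SVars r k // v ≠ lastVar r k i hki} → ℂ,
        (∀ q ∈ N, q.1 s ≠ q.2) →
        (∃ c : ℂ,
          Tendsto (fun x : ℂ => omegaPt r k J (extendAt r k (lastVar r k i hki) s x))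
            (𝓝[≠] (0 : ℂ)) (𝓝 c)) ∧
        Tendsto (fun x : ℂ => x * omegaPt r k J (extendAt r k (lastVar r k i hki) s x))
          (𝓝[≠] (0 : ℂ)) (𝓝 (0 : ℂ)) := by
  classical
  refine ⟨univ.image fun v => (LinearMap.proj v, 0), ?_, fun s hs => ?_⟩
  · simp only [mem_image, mem_univ, true_and, forall_exists_index]
    rintro _ v rfl h
    simpa using LinearMap.congr_fun h (fun _ => 1)
  · have hs' : ∀ v, s v ≠ 0 := fun v =>
      hs (LinearMap.proj v, 0) (mem_image_of_mem _ (mem_univ v))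
    obtain ⟨c, hc⟩ := exists_tendsto_omegaPt_extendAt hJ (fun _ => hJ0) hs'
    refine ⟨⟨c, hc⟩, ?_⟩
    have hid : Tendsto (fun x : ℂ => x) (𝓝[≠] 0) (𝓝 0) :=
      tendsto_id.mono_left nhdsWithin_le_nhds
    simpa using hid.mul hc
end

section
/- Residue recursion for the type B_r diamond functions: let r≥4 and let i, j satisfy 1≤i, i+2≤j≤r−1. Then, for every choice of the variables other than x := t^{(j−1)}_2 lying outside a finite union of affine hyperplanes, the rational function x·φ_{i,j−1} extends regularly to x=0 and lim_{x→0} x·φ_{i,j−1} = φ_{i,j}, where on the right the remaining color-(j−1) variable t^{(j−1)}_1 of φ_{i,j−1} serves as the single color-(j−1) variable of φ_{i,j}. -/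
open Finset Filter Topology

/-- The value of the variable `t⁽ᶜ⁾_a` (`1`-based color `c` and lower index `a`), after
applying the permutation `π ∈ G_k` to the lower indices, at the point `t`. -/
noncomputable def tvp (r : ℕ) (k : Fin r → ℕ) (π : ∀ i, Equiv.Perm (Fin (k i)))
    (t : SVars r k → ℂ) (c a : ℕ) : ℂ :=
  if h : c - 1 < r then
    if h2 : a - 1 < k ⟨c - 1, h⟩ then t ⟨⟨c - 1, h⟩, (π ⟨c - 1, h⟩) ⟨a - 1, h2⟩⟩ else 0
  else 0

/-- The content `k(i,j) = (0^{i−1}, 1^{j−i}, 2^{r−j+1})` (1-based colors). -/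
def contB (r i j : ℕ) : Fin r → ℕ :=
  fun u => if (u : ℕ) + 1 < i then 0 else if (u : ℕ) + 1 < j then 1 else 2

/-- The `s`-variables of the type `B_r` diamond function:
`s⁽ᵘ⁾ = t⁽ᵘ⁾₂` for `j ≤ u ≤ r−1` and `s⁽ᵘ⁾ = t⁽ᵘ⁾₁` for `i ≤ u ≤ j−1`. -/
noncomputable def svB (r i j : ℕ) (π : ∀ u, Equiv.Perm (Fin (contB r i j u)))
    (t : SVars r (contB r i j) → ℂ) (u : ℕ) : ℂ :=
  if u < j then tvp r (contB r i j) π t u 1 else tvp r (contB r i j) π t u 2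

/-- The type `B_r` diamond function `φ_{i,j} = η_{ε_i+ε_j}`. -/
noncomputable def phiB (r i j : ℕ) (t : SVars r (contB r i j) → ℂ) : ℂ :=
  (1 / 2 : ℂ) * ∑ π : ∀ u, Equiv.Perm (Fin (contB r i j u)),
    (tvp r _ π t (r - 1) 1 - tvp r _ π t (r - 1) 2) /
      (tvp r _ π t j 1 *
        ((tvp r _ π t r 1 - tvp r _ π t (r - 1) 1) *
          ((tvp r _ π t r 2 - tvp r _ π t (r - 1) 1) *
            ((tvp r _ π t (r - 1) 2 - tvp r _ π t r 1) *
              (tvp r _ π t (r - 1) 2 - tvp r _ π t r 2)))) *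
        (∏ u ∈ Finset.Icc (j + 1) (r - 1), (tvp r _ π t u 1 - tvp r _ π t (u - 1) 1)) *
        (∏ u ∈ Finset.Icc i (r - 2), (svB r i j π t u - svB r i j π t (u + 1))))

/-- A permutation for the content `k'` extended to the content `k`, where the single lower index
of color `m` is replaced by two, which are swapped. -/
def extendPerm {r : ℕ} {k k' : Fin r → ℕ} {m : Fin r} (h2 : k m = 2)
    (hk : ∀ u, u ≠ m → k' u = k u) (π : ∀ u, Equiv.Perm (Fin (k' u))) :
    ∀ u, Equiv.Perm (Fin (k u)) :=
  fun u => if hu : u = m then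
      (finCongr (show 2 = k u by rw [hu, h2])).permCongr (Equiv.swap 0 1)
    else (finCongr (hk u hu)).permCongr (π u)

lemma extendPerm_injective {r : ℕ} {k k' : Fin r → ℕ} {m : Fin r} (h2 : k m = 2)
    (hk : ∀ u, u ≠ m → k' u = k u) (h1 : k' m = 1) :
    Function.Injective (extendPerm h2 hk) := by
  intro π π' h
  funext u
  by_cases hu : u = m
  · subst hu
    have : Subsingleton (Fin (k' u)) := by rw [h1]; infer_instance
    exact Subsingleton.elim _ _
  · have h' := congrFun h u
    simp only [extendPerm, hu, dite_false] at h'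
    exact (Equiv.injective _) h'

lemma perm_eq_swap_of_eq_two {n : ℕ} (h : 2 = n) (σ : Equiv.Perm (Fin n)) (hσ : σ ≠ 1) :
    σ = (finCongr h).permCongr (Equiv.swap 0 1) := by
  subst h
  revert σ
  decide

lemma exists_extendPerm_eq {r : ℕ} {k k' : Fin r → ℕ} {m : Fin r} (h2 : k m = 2)
    (hk : ∀ u, u ≠ m → k' u = k u) (π : ∀ u, Equiv.Perm (Fin (k u))) (hπ : π m ≠ 1) :
    ∃ π', extendPerm h2 hk π' = π := by
  refine ⟨fun u => if hu : u = m then 1 else (finCongr (hk u hu)).permCongr.symm (π u), ?_⟩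
  funext u
  by_cases hu : u = m
  · subst hu
    simp only [extendPerm, dite_true]
    exact (perm_eq_swap_of_eq_two _ _ hπ).symm
  · simp only [extendPerm, hu, dite_false]
    exact Equiv.apply_symm_apply _ _

/-- A variable evaluated at `extendAt s x` is a coordinate of `s`, or it is `x` itself. -/
lemma tvp_extendAt_cases {r : ℕ} {k : Fin r → ℕ} {v0 : SVars r k}
    (s : {v : SVars r k // v ≠ v0} → ℂ) (π : ∀ u, Equiv.Perm (Fin (k u))) {c a : ℕ}
    (hc : c - 1 < r) (ha : a - 1 < k ⟨c - 1, hc⟩) :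
    (∃ v, ∀ x, tvp r k π (extendAt r k v0 s x) c a = s v) ∨
      (c - 1 = v0.1 ∧ ∀ x, tvp r k π (extendAt r k v0 s x) c a = x) := by
  by_cases hv : (⟨⟨c - 1, hc⟩, π ⟨c - 1, hc⟩ ⟨a - 1, ha⟩⟩ : SVars r k) = v0
  · right
    refine ⟨by rw [← hv], fun x => ?_⟩
    simp only [tvp, hc, ha, dite_true, extendAt, hv]
  · left
    refine ⟨⟨_, hv⟩, fun x => ?_⟩
    simp only [tvp, hc, ha, dite_true, extendAt, hv, dite_false]

lemma tvp_extendAt_of_ne {r : ℕ} {k : Fin r → ℕ} {v0 : SVars r k}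
    (s : {v : SVars r k // v ≠ v0} → ℂ) (π : ∀ u, Equiv.Perm (Fin (k u))) {c : ℕ} (a : ℕ)
    (hc : c - 1 ≠ v0.1) (x y : ℂ) :
    tvp r k π (extendAt r k v0 s x) c a = tvp r k π (extendAt r k v0 s y) c a := by
  by_cases hr : c - 1 < r
  · by_cases ha : a - 1 < k ⟨c - 1, hr⟩
    · rcases tvp_extendAt_cases s π hr ha with ⟨v, hv⟩ | h
      · rw [hv, hv]
      · exact absurd h.1 hc
    · simp only [tvp, hr, ha, dite_true, dite_false]
  · simp only [tvp, hr, dite_false]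

lemma tendsto_inv_tvp_sub_tvp {r : ℕ} {k : Fin r → ℕ} {v0 : SVars r k}
    {s : {v : SVars r k // v ≠ v0} → ℂ} (hs : ∀ v, s v ≠ 0)
    (π : ∀ u, Equiv.Perm (Fin (k u))) {c a d b : ℕ} (hcd : c - 1 ≠ d - 1)
    (hc : c - 1 < r) (ha : a - 1 < k ⟨c - 1, hc⟩)
    (hd : d - 1 < r) (hb : b - 1 < k ⟨d - 1, hd⟩) :
    Tendsto (fun x => (tvp r k π (extendAt r k v0 s x) c a -
        tvp r k π (extendAt r k v0 s x) d b)⁻¹) (𝓝 0)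
      (𝓝 (tvp r k π (extendAt r k v0 s 0) c a - tvp r k π (extendAt r k v0 s 0) d b)⁻¹) := by
  rcases tvp_extendAt_cases s π hc ha with ⟨v, hv⟩ | ⟨hc', hv⟩ <;>
    rcases tvp_extendAt_cases s π hd hb with ⟨w, hw⟩ | ⟨hd', hw⟩ <;> simp only [hv, hw]
  · exact tendsto_const_nhds
  · exact (tendsto_const_nhds.sub tendsto_id).inv₀ (by simpa using hs v)
  · exact (tendsto_id.sub tendsto_const_nhds).inv₀ (by simpa using hs w)
  · exact absurd (hc'.trans hd'.symm) hcd

/-- The summand of the diamond function without its factor `1 / t⁽ʲ⁾₁`. -/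
noncomputable def diamondCore (r i j : ℕ) (π : ∀ u, Equiv.Perm (Fin (contB r i j u)))
    (t : SVars r (contB r i j) → ℂ) : ℂ :=
  (tvp r _ π t (r - 1) 1 - tvp r _ π t (r - 1) 2) *
    ((tvp r _ π t r 1 - tvp r _ π t (r - 1) 1) *
      ((tvp r _ π t r 2 - tvp r _ π t (r - 1) 1) *
        ((tvp r _ π t (r - 1) 2 - tvp r _ π t r 1) *
          (tvp r _ π t (r - 1) 2 - tvp r _ π t r 2))))⁻¹ *
    (∏ u ∈ Finset.Icc (j + 1) (r - 1), (tvp r _ π t u 1 - tvp r _ π t (u - 1) 1)⁻¹) *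
    (∏ u ∈ Finset.Icc i (r - 2), (svB r i j π t u - svB r i j π t (u + 1))⁻¹)

lemma phiB_eq_sum_diamondCore (r i j : ℕ) (t : SVars r (contB r i j) → ℂ) :
    phiB r i j t = (1 / 2 : ℂ) * ∑ π : ∀ u, Equiv.Perm (Fin (contB r i j u)),
      (tvp r _ π t j 1)⁻¹ * diamondCore r i j π t := by
  unfold phiB
  congr 1
  refine Finset.sum_congr rfl fun π _ => ?_
  simp only [diamondCore, Finset.prod_inv_distrib, div_eq_mul_inv, mul_inv]
  ring

lemma contB_eq_two {r i j : ℕ} {u : Fin r} (hij : i ≤ j) (hu : j ≤ (u : ℕ) + 1) :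
    contB r i j u = 2 := by
  simp only [contB]
  split_ifs <;> omega

lemma contB_pos {r i j : ℕ} {u : Fin r} (hu : i ≤ (u : ℕ) + 1) : 0 < contB r i j u := by
  simp only [contB]
  split_ifs <;> omega

lemma tendsto_diamondCore {r i j : ℕ} (hi : 1 ≤ i) (hij : i ≤ j) (hj : j + 2 ≤ r)
    {v0 : SVars r (contB r i j)} (hv0 : (v0.1 : ℕ) = j - 1)
    {s : {v : SVars r (contB r i j) // v ≠ v0} → ℂ} (hs : ∀ v, s v ≠ 0)
    (π : ∀ u, Equiv.Perm (Fin (contB r i j u))) :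
    Tendsto (fun x => diamondCore r i j π (extendAt r _ v0 s x)) (𝓝 0)
      (𝓝 (diamondCore r i j π (extendAt r _ v0 s 0))) := by
  unfold diamondCore
  refine Tendsto.mul (Tendsto.mul (Tendsto.congr (fun x => ?_) tendsto_const_nhds) ?_) ?_
  · have h1 : ∀ a, tvp r _ π (extendAt r _ v0 s 0) (r - 1) a =
        tvp r _ π (extendAt r _ v0 s x) (r - 1) a :=
      fun a => tvp_extendAt_of_ne s π a (by omega) 0 x
    have h2 : ∀ a, tvp r _ π (extendAt r _ v0 s 0) r a =
        tvp r _ π (extendAt r _ v0 s x) r a :=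
      fun a => tvp_extendAt_of_ne s π a (by omega) 0 x
    simp only [h1, h2]
  · refine tendsto_finsetProd _ fun u hu => ?_
    rw [Finset.mem_Icc] at hu
    exact tendsto_inv_tvp_sub_tvp hs π (by omega) (by omega) (contB_pos (by simp only; omega))
      (by omega) (contB_pos (by simp only; omega))
  · refine tendsto_finsetProd _ fun u hu => ?_
    rw [Finset.mem_Icc] at hu
    have h1 : ∀ c (hc : c - 1 < r), i ≤ c → 1 - 1 < contB r i j ⟨c - 1, hc⟩ :=
      fun c hc h => contB_pos (by simp only; omega)
    have h2 : ∀ c (hc : c - 1 < r), ¬ c < j → 2 - 1 < contB r i j ⟨c - 1, hc⟩ := by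
      intro c hc h
      rw [contB_eq_two hij (by simp only; omega)]
      norm_num
    unfold svB
    split_ifs <;>
      exact tendsto_inv_tvp_sub_tvp hs π (by omega) (by omega)
        (by first | exact h1 _ _ (by omega) | exact h2 _ _ (by omega)) (by omega)
        (by first | exact h1 _ _ (by omega) | exact h2 _ _ (by omega))

lemma tvp_extendPerm_of_ne {r : ℕ} {k k' : Fin r → ℕ} {v0 : SVars r k} (h2 : k v0.1 = 2)
    (hk : ∀ u, u ≠ v0.1 → k' u = k u) (hle : ∀ u, k' u ≤ k u) (hv0 : k' v0.1 ≤ (v0.2 : ℕ))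
    (π : ∀ u, Equiv.Perm (Fin (k' u))) (s : {v : SVars r k // v ≠ v0} → ℂ) (x : ℂ)
    {c : ℕ} (a : ℕ) (hc : c - 1 ≠ v0.1) :
    tvp r k (extendPerm h2 hk π) (extendAt r k v0 s x) c a =
      tvp r k' π (fun v => s (restrictVar r k k' hle v0 hv0 v)) c a := by
  by_cases hr : c - 1 < r
  · have hu : (⟨c - 1, hr⟩ : Fin r) ≠ v0.1 := fun h => hc (congrArg Fin.val h)
    have hku := hk _ hu
    by_cases ha : a - 1 < k ⟨c - 1, hr⟩
    · have ha' : a - 1 < k' ⟨c - 1, hr⟩ := by omega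
      have hv : ∀ b, (⟨⟨c - 1, hr⟩, b⟩ : SVars r k) ≠ v0 := by
        rintro b rfl
        exact hu rfl
      simp only [tvp, hr, ha, ha', dite_true, extendAt, hv, dite_false, extendPerm, hu]
      rfl
    · have ha' : ¬ a - 1 < k' ⟨c - 1, hr⟩ := by omega
      simp only [tvp, hr, ha, ha', dite_true, dite_false]
  · simp only [tvp, hr, dite_false]

lemma tvp_extendPerm_one {r : ℕ} {k k' : Fin r → ℕ} {m : Fin r} (hm : 1 < k m) (h2 : k m = 2)
    (hk : ∀ u, u ≠ m → k' u = k u) (π : ∀ u, Equiv.Perm (Fin (k' u)))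
    (s : {v : SVars r k // v ≠ ⟨m, ⟨1, hm⟩⟩} → ℂ) (x : ℂ) {c : ℕ} (hc : c - 1 = m) :
    tvp r k (extendPerm h2 hk π) (extendAt r k ⟨m, ⟨1, hm⟩⟩ s x) c 1 = x := by
  obtain ⟨m, hmr⟩ := m
  obtain rfl : c - 1 = m := hc
  have h0 : 1 - 1 < k ⟨c - 1, hmr⟩ := by omega
  simp only [tvp, hmr, h0, dite_true, extendPerm, extendAt]
  rw [dif_pos]
  congr 1

lemma tvp_extendPerm_two {r : ℕ} {k k' : Fin r → ℕ} {m : Fin r} (hm : 1 < k m) (h2 : k m = 2)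
    (hk : ∀ u, u ≠ m → k' u = k u) (h1 : k' m = 1) (hle : ∀ u, k' u ≤ k u)
    (hv0 : k' m ≤ 1) (π : ∀ u, Equiv.Perm (Fin (k' u)))
    (s : {v : SVars r k // v ≠ ⟨m, ⟨1, hm⟩⟩} → ℂ) (x : ℂ) {c : ℕ} (hc : c - 1 = m) :
    tvp r k (extendPerm h2 hk π) (extendAt r k ⟨m, ⟨1, hm⟩⟩ s x) c 2 =
      tvp r k' π (fun v => s (restrictVar r k k' hle ⟨m, ⟨1, hm⟩⟩ hv0 v)) c 1 := by
  obtain ⟨m, hmr⟩ := m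
  obtain rfl : c - 1 = m := hc
  have h0 : 2 - 1 < k ⟨c - 1, hmr⟩ := by omega
  have h0' : 1 - 1 < k' ⟨c - 1, hmr⟩ := by omega
  simp only [tvp, hmr, h0, h0', dite_true, extendPerm, extendAt]
  have hsw : ((finCongr h2.symm).permCongr (Equiv.swap 0 1)) ⟨2 - 1, h0⟩ =
      (⟨0, by omega⟩ : Fin (k ⟨c - 1, hmr⟩)) := Fin.ext rfl
  rw [dif_neg]
  · congr 1
    apply Subtype.ext
    simp only [restrictVar, hsw]
    congr 2
    have := (π ⟨c - 1, hmr⟩ ⟨1 - 1, h0'⟩).isLt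
    omega
  · rw [hsw]
    simp

lemma tvp_extendAt_of_perm_eq_one {r : ℕ} {k : Fin r → ℕ} {m : Fin r} (hm : 1 < k m)
    (π : ∀ u, Equiv.Perm (Fin (k u))) (hπ : π m = 1)
    (s : {v : SVars r k // v ≠ ⟨m, ⟨1, hm⟩⟩} → ℂ) (x y : ℂ) {c : ℕ} (hc : c - 1 = m) :
    tvp r k π (extendAt r k ⟨m, ⟨1, hm⟩⟩ s x) c 1 =
      tvp r k π (extendAt r k ⟨m, ⟨1, hm⟩⟩ s y) c 1 := by
  obtain ⟨m, hmr⟩ := m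
  obtain rfl : c - 1 = m := hc
  have h0 : 1 - 1 < k ⟨c - 1, hmr⟩ := by omega
  simp [tvp, hmr, h0, hπ, extendAt]

lemma diamondCore_extendPerm {r i j : ℕ} (hi : 1 ≤ i) (hij : i + 2 ≤ j) (hj : j ≤ r - 1)
    {m : Fin r} (hmj : (m : ℕ) = j - 2) (hm : 1 < contB r i (j - 1) m)
    (h2 : contB r i (j - 1) m = 2) (hk : ∀ u, u ≠ m → contB r i j u = contB r i (j - 1) u)
    (h1 : contB r i j m = 1) (hle : ∀ u, contB r i j u ≤ contB r i (j - 1) u)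
    (hv0 : contB r i j m ≤ 1) (π : ∀ u, Equiv.Perm (Fin (contB r i j u)))
    (s : {v : SVars r (contB r i (j - 1)) // v ≠ ⟨m, ⟨1, hm⟩⟩} → ℂ) :
    diamondCore r i (j - 1) (extendPerm h2 hk π) (extendAt r _ ⟨m, ⟨1, hm⟩⟩ s 0) =
      (tvp r _ π (fun v => s (restrictVar r _ _ hle ⟨m, ⟨1, hm⟩⟩ hv0 v)) j 1)⁻¹ *
        diamondCore r i j π (fun v => s (restrictVar r _ _ hle ⟨m, ⟨1, hm⟩⟩ hv0 v)) := by
  have hne : ∀ c a, c - 1 ≠ j - 2 →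
      tvp r _ (extendPerm h2 hk π) (extendAt r _ ⟨m, ⟨1, hm⟩⟩ s 0) c a =
        tvp r _ π (fun v => s (restrictVar r _ _ hle ⟨m, ⟨1, hm⟩⟩ hv0 v)) c a :=
    fun c a hc => tvp_extendPerm_of_ne (v0 := ⟨m, ⟨1, hm⟩⟩) h2 hk hle hv0 π s 0 a
      (by simpa only [hmj] using hc)
  have hsv : ∀ u, 1 ≤ u →
      svB r i (j - 1) (extendPerm h2 hk π) (extendAt r _ ⟨m, ⟨1, hm⟩⟩ s 0) u =
        svB r i j π (fun v => s (restrictVar r _ _ hle ⟨m, ⟨1, hm⟩⟩ hv0 v)) u := by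
    intro u hu
    unfold svB
    by_cases huj : u = j - 1
    · rw [if_neg (by omega), if_pos (by omega)]
      exact tvp_extendPerm_two hm h2 hk h1 hle hv0 π s 0 (by omega)
    · by_cases hlt : u < j - 1
      · rw [if_pos hlt, if_pos (by omega), hne _ _ (by omega)]
      · rw [if_neg hlt, if_neg (by omega), hne _ _ (by omega)]
  unfold diamondCore
  rw [show j - 1 + 1 = j by omega, ← Finset.mul_prod_Ioc_eq_prod_Icc hj,
    ← Finset.Icc_add_one_left_eq_Ioc,
    tvp_extendPerm_one hm h2 hk π s 0 (show j - 1 - 1 = (m : ℕ) by omega), sub_zero,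
    hne j 1 (by omega), hne r 1 (by omega), hne r 2 (by omega), hne (r - 1) 1 (by omega),
    hne (r - 1) 2 (by omega)]
  have hP : ∀ u ∈ Finset.Icc (j + 1) (r - 1), _ := fun u hu =>
    congrArg₂ (fun p q : ℂ => (p - q)⁻¹)
      (hne u 1 (by rw [Finset.mem_Icc] at hu; omega))
      (hne (u - 1) 1 (by rw [Finset.mem_Icc] at hu; omega))
  have hS : ∀ u ∈ Finset.Icc i (r - 2), _ := fun u hu =>
    congrArg₂ (fun p q : ℂ => (p - q)⁻¹)
      (hsv u (by rw [Finset.mem_Icc] at hu; omega)) (hsv (u + 1) (by omega))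
  rw [Finset.prod_congr rfl hP, Finset.prod_congr rfl hS]
  ring

lemma tendsto_mul_phiB {r i j : ℕ} (hi : 1 ≤ i) (hij : i + 2 ≤ j) (hj : j ≤ r - 1)
    {m : Fin r} (hmj : (m : ℕ) = j - 2) (hm : 1 < contB r i (j - 1) m)
    (hle : ∀ u, contB r i j u ≤ contB r i (j - 1) u) (hv0 : contB r i j m ≤ 1)
    (s : {v : SVars r (contB r i (j - 1)) // v ≠ ⟨m, ⟨1, hm⟩⟩} → ℂ) (hs : ∀ v, s v ≠ 0) :
    Tendsto (fun x : ℂ => x * phiB r i (j - 1) (extendAt r _ ⟨m, ⟨1, hm⟩⟩ s x)) (𝓝[≠] 0)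
      (𝓝 (phiB r i j (fun v => s (restrictVar r _ _ hle ⟨m, ⟨1, hm⟩⟩ hv0 v)))) := by
  classical
  have h2 : contB r i (j - 1) m = 2 := contB_eq_two (by omega) (by omega)
  have h1 : contB r i j m = 1 := le_antisymm hv0 (contB_pos (by omega))
  have hk : ∀ u, u ≠ m → contB r i j u = contB r i (j - 1) u := by
    intro u hu
    have : (u : ℕ) ≠ m := fun h => hu (Fin.ext h)
    simp only [contB]
    split_ifs <;> omega
  have hcore := fun π => (tendsto_diamondCore (v0 := ⟨m, ⟨1, hm⟩⟩) hi
    (show i ≤ j - 1 by omega) (by omega) (by simp only; omega) hs π).mono_left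
      (nhdsWithin_le_nhds (s := {0}ᶜ))
  have hterm : ∀ π, Tendsto (fun x => x *
      ((tvp r _ π (extendAt r _ ⟨m, ⟨1, hm⟩⟩ s x) (j - 1) 1)⁻¹ *
        diamondCore r i (j - 1) π (extendAt r _ ⟨m, ⟨1, hm⟩⟩ s x))) (𝓝[≠] 0)
      (𝓝 (if π m = 1 then 0 else
        diamondCore r i (j - 1) π (extendAt r _ ⟨m, ⟨1, hm⟩⟩ s 0))) := by
    intro π
    split_ifs with hπ
    · have hx : Tendsto (fun x : ℂ => x) (𝓝[≠] 0) (𝓝 0) := nhdsWithin_le_nhds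
      have := hx.mul ((tendsto_const_nhds (x :=
        (tvp r _ π (extendAt r _ ⟨m, ⟨1, hm⟩⟩ s 0) (j - 1) 1)⁻¹)).mul (hcore π))
      rw [zero_mul] at this
      refine this.congr fun x => ?_
      rw [tvp_extendAt_of_perm_eq_one hm π hπ s 0 x (by omega)]
    · obtain ⟨π', rfl⟩ := exists_extendPerm_eq h2 hk π hπ
      refine (hcore _).congr' ?_
      filter_upwards [self_mem_nhdsWithin] with x hx
      rw [tvp_extendPerm_one hm h2 hk π' s x (by omega), mul_inv_cancel_left₀ hx]
  have hsum := (tendsto_finsetSum Finset.univ fun π _ => hterm π).const_mul (1 / 2 : ℂ)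
  simp only [phiB_eq_sum_diamondCore]
  convert hsum using 2
  · rw [← Finset.mul_sum]
    ring
  · congr 1
    refine Finset.sum_of_injOn (extendPerm h2 hk) (extendPerm_injective h2 hk h1).injOn
      (fun _ _ => Finset.mem_coe.2 (Finset.mem_univ _)) (fun π _ hπ => ?_) (fun π _ => ?_)
    · refine if_pos (not_not.1 fun h => hπ ?_)
      obtain ⟨π', rfl⟩ := exists_extendPerm_eq h2 hk π h
      exact ⟨π', Finset.mem_coe.2 (Finset.mem_univ _), rfl⟩
    · rw [if_neg, diamondCore_extendPerm hi hij hj hmj hm h2 hk h1 hle hv0]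
      intro h
      have hval := congrArg (fun σ => ((σ ⟨0, by omega⟩ : Fin _) : ℕ)) h
      simp [extendPerm] at hval

/-- residue recursion for the type `B_r` diamond functions: for
`1 ≤ i`, `i+2 ≤ j ≤ r−1`, generically in the variables other than `x := t^{(j−1)}_2`,
the function `x·φ_{i,j−1}` extends regularly to `x = 0` with limit `φ_{i,j}` (the
remaining color-`(j−1)` variable `t^{(j−1)}_1` serving as the single color-`(j−1)`
variable of `φ_{i,j}`). -/
theorem residue_recursion_B_diamond (r : ℕ) (hr : 4 ≤ r) (i j : ℕ)
    (hi : 1 ≤ i) (hij : i + 2 ≤ j) (hj : j ≤ r - 1) :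
    ∃ N : Finset ((({v : SVars r (contB r i (j - 1)) //
          v ≠ ⟨⟨j - 2, by omega⟩, ⟨1, by
            simp only [contB]
            split_ifs <;> omega⟩⟩} → ℂ) →ₗ[ℂ] ℂ) × ℂ),
      (∀ q ∈ N, q.1 ≠ 0) ∧
      ∀ s : {v : SVars r (contB r i (j - 1)) //
          v ≠ ⟨⟨j - 2, by omega⟩, ⟨1, by simp only [contB]; split_ifs <;> omega⟩⟩} → ℂ,
        (∀ q ∈ N, q.1 s ≠ q.2) →
        Tendsto
          (fun x : ℂ => x * phiB r i (j - 1)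
            (extendAt r (contB r i (j - 1)) _ s x))
          (𝓝[≠] (0 : ℂ))
          (𝓝 (phiB r i j (fun v => s (restrictVar r (contB r i (j - 1)) (contB r i j)
            (by intro u; simp only [contB]; split_ifs <;> omega)
            ⟨⟨j - 2, by omega⟩, ⟨1, by simp only [contB]; split_ifs <;> omega⟩⟩
            (by simp only [contB]; split_ifs <;> omega) v)))) := by
  classical
  refine ⟨Finset.univ.image fun v => (LinearMap.proj v, 0), ?_, fun s hs => ?_⟩
  · intro q hq h
    obtain ⟨v, -, rfl⟩ := Finset.mem_image.1 hq
    simpa using LinearMap.congr_fun h (fun _ => 1)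
  · exact tendsto_mul_phiB hi hij hj rfl _ _ _ s fun v =>
      hs _ (Finset.mem_image_of_mem _ (Finset.mem_univ v))
end

section
/- Residue of the type C_r function η_{2ε_i}: let r≥2 and 1≤i≤r−1. Then, for every choice of the variables t^{(u)}_1, t^{(u)}_2 (i≤u≤r−1) lying outside a finite union of affine hyperplanes, the rational function x·ψ_i of x := t^{(r)}_1 extends regularly to x=0 and lim_{x→0} x·ψ_i = (1/2)·(χ_i * χ_i), evaluated at the variables t^{(u)}_1, t^{(u)}_2 (i≤u≤r−1). -/
open Finset Filter Topology

/-- The content `c = (0^{i−1}, 2^{r−i}, 1)` (1-based colors). -/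
def contC2 (r i : ℕ) : Fin r → ℕ :=
  fun u => if (u : ℕ) + 1 < i then 0 else if (u : ℕ) + 1 ≤ r - 1 then 2 else 1

/-- The content `(0^{i−1}, 2^{r−i}, 0)` of `χ_i * χ_i` (1-based colors). -/
def contC2' (r i : ℕ) : Fin r → ℕ :=
  fun u => if (u : ℕ) + 1 < i then 0 else if (u : ℕ) + 1 ≤ r - 1 then 2 else 0

/-- The type `C_r` function `ψ_i = η_{2ε_i}`. -/
noncomputable def psiC (r i : ℕ) (t : SVars r (contC2 r i) → ℂ) : ℂ :=
  (1 / 2 : ℂ) * ∑ π : ∀ u, Equiv.Perm (Fin (contC2 r i u)),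
    (tvp r _ π t r 1 *
      ((tvp r _ π t (r - 1) 1 - tvp r _ π t r 1) *
        (tvp r _ π t (r - 1) 2 - tvp r _ π t r 1)) *
      (∏ u ∈ Finset.Icc i (r - 2), (tvp r _ π t u 1 - tvp r _ π t (u + 1) 1)) *
      (∏ u ∈ Finset.Icc i (r - 2), (tvp r _ π t u 2 - tvp r _ π t (u + 1) 2)))⁻¹

/-- The function `χ_i = η_{ε_i−ε_r}`, evaluated on the copy-`(b+1)` variables of each
color (`b = 0` for the first factor of the star product, `b = 1` for the second). -/
noncomputable def chiC (r i : ℕ) (ρ : ∀ u, Equiv.Perm (Fin (contC2' r i u)))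
    (t : SVars r (contC2' r i) → ℂ) (b : ℕ) : ℂ :=
  (tvp r _ ρ t (r - 1) (b + 1) *
    ∏ u ∈ Finset.Icc i (r - 2), (tvp r _ ρ t u (b + 1) - tvp r _ ρ t (u + 1) (b + 1)))⁻¹

/-- Permutation groups of two finite ordinals that are equal or both have at most one element
are in bijection, compatibly with the underlying values when the ordinals are equal. -/
theorem exists_perm_equiv (m m' : ℕ) (h : m = m' ∨ m ≤ 1 ∧ m' ≤ 1) :
    ∃ e : Equiv.Perm (Fin m) ≃ Equiv.Perm (Fin m'),
      m = m' → ∀ (π : Equiv.Perm (Fin m)) (n : ℕ) (hn : n < m) (hn' : n < m'),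
        ((e π ⟨n, hn'⟩ : Fin m') : ℕ) = (π ⟨n, hn⟩ : Fin m) := by
  by_cases hm : m = m'
  · subst hm
    exact ⟨Equiv.refl _, fun _ _ _ _ _ => rfl⟩
  · obtain ⟨h1, h2⟩ := h.resolve_left hm
    have : Subsingleton (Fin m) := Fin.subsingleton_iff_le_one.mpr h1
    have : Subsingleton (Fin m') := Fin.subsingleton_iff_le_one.mpr h2
    exact ⟨⟨fun _ => 1, fun _ => 1, fun _ => Subsingleton.elim _ _,
      fun _ => Subsingleton.elim _ _⟩, fun h => absurd h hm⟩

/-- The variables other than `v0` take the same values before and after restriction. -/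
theorem tvp_extendAt {r : ℕ} {k k' : Fin r → ℕ} (hk : ∀ i, k' i ≤ k i) (v0 : SVars r k)
    (hv0 : k' v0.1 ≤ (v0.2 : ℕ)) (π : ∀ i, Equiv.Perm (Fin (k i)))
    (ρ : ∀ i, Equiv.Perm (Fin (k' i))) (s : {v : SVars r k // v ≠ v0} → ℂ) (x : ℂ) (c a : ℕ)
    (hc : c - 1 < r) (ha : a - 1 < k' ⟨c - 1, hc⟩)
    (h : ((ρ ⟨c - 1, hc⟩ ⟨a - 1, ha⟩ : Fin _) : ℕ)
      = (π ⟨c - 1, hc⟩ ⟨a - 1, ha.trans_le (hk _)⟩ : Fin _)) :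
    tvp r k π (extendAt r k v0 s x) c a =
      tvp r k' ρ (fun v => s (restrictVar r k k' hk v0 hv0 v)) c a := by
  have hv : (⟨⟨c - 1, hc⟩, π ⟨c - 1, hc⟩ ⟨a - 1, ha.trans_le (hk _)⟩⟩ : SVars r k) =
      (restrictVar r k k' hk v0 hv0 ⟨⟨c - 1, hc⟩, ρ ⟨c - 1, hc⟩ ⟨a - 1, ha⟩⟩).1 := by
    unfold restrictVar
    congr 1
    exact Fin.ext h.symm
  unfold tvp
  rw [dif_pos hc, dif_pos (ha.trans_le (hk _)), dif_pos hc, dif_pos ha, hv, extendAt,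
    dif_neg (restrictVar r k k' hk v0 hv0 _).2]

/-- The residue at `x = 0` of a single term, written as a limit. -/
theorem tendsto_mul_inv_simple_pole {a b : ℂ} (ha : a ≠ 0) (hb : b ≠ 0) (P Q : ℂ) :
    Tendsto (fun x : ℂ => x * (x * ((a - x) * (b - x)) * P * Q)⁻¹) (𝓝[≠] (0 : ℂ))
      (𝓝 ((a * P)⁻¹ * (b * Q)⁻¹)) := by
  have hcont : ContinuousAt (fun x : ℂ => ((a - x) * (b - x))⁻¹ * (P⁻¹ * Q⁻¹)) 0 := by
    refine ContinuousAt.mul (ContinuousAt.inv₀ (by fun_prop) ?_) continuousAt_const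
    simpa using ⟨ha, hb⟩
  have hlim := hcont.tendsto.mono_left (nhdsWithin_le_nhds (s := {0}ᶜ))
  have hval : (a * P)⁻¹ * (b * Q)⁻¹ = ((a - 0) * (b - 0))⁻¹ * (P⁻¹ * Q⁻¹) := by
    simp only [sub_zero, mul_inv]
    ring
  rw [hval]
  refine hlim.congr' ?_
  filter_upwards [self_mem_nhdsWithin] with x hx
  simp only [mul_inv, mul_assoc]
  rw [mul_inv_cancel_left₀ hx]

/-- residue of the type `C_r` function `η_{2ε_i}`: for `1 ≤ i ≤ r−1`,
generically in the variables other than `x := t^{(r)}_1`, the function `x·ψ_i` extends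
regularly to `x = 0` with limit `(1/2)·(χ_i * χ_i)`, where
`(χ_i * χ_i) = Σ_{π ∈ G_{c'}} π·(χ_i(copy 1 variables)·χ_i(copy 2 variables))`. -/
theorem residue_C_two_epsilon (r : ℕ) (hr : 2 ≤ r) (i : ℕ) (hi : 1 ≤ i) (hir : i ≤ r - 1) :
    ∃ N : Finset ((({v : SVars r (contC2 r i) //
          v ≠ ⟨⟨r - 1, by omega⟩, ⟨0, by simp only [contC2]; split_ifs <;> omega⟩⟩} → ℂ)
            →ₗ[ℂ] ℂ) × ℂ),
      (∀ q ∈ N, q.1 ≠ 0) ∧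
      ∀ s : {v : SVars r (contC2 r i) //
          v ≠ ⟨⟨r - 1, by omega⟩, ⟨0, by simp only [contC2]; split_ifs <;> omega⟩⟩} → ℂ,
        (∀ q ∈ N, q.1 s ≠ q.2) →
        Tendsto
          (fun x : ℂ => x * psiC r i (extendAt r (contC2 r i) _ s x))
          (𝓝[≠] (0 : ℂ))
          (𝓝 ((1 / 2 : ℂ) * ∑ ρ : ∀ u, Equiv.Perm (Fin (contC2' r i u)),
            chiC r i ρ (fun v => s (restrictVar r (contC2 r i) (contC2' r i)
              (by intro u; simp only [contC2, contC2']; split_ifs <;> omega)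
              ⟨⟨r - 1, by omega⟩, ⟨0, by simp only [contC2]; split_ifs <;> omega⟩⟩
              (by simp only [contC2']; split_ifs <;> omega) v)) 0 *
            chiC r i ρ (fun v => s (restrictVar r (contC2 r i) (contC2' r i)
              (by intro u; simp only [contC2, contC2']; split_ifs <;> omega)
              ⟨⟨r - 1, by omega⟩, ⟨0, by simp only [contC2]; split_ifs <;> omega⟩⟩
              (by simp only [contC2']; split_ifs <;> omega) v)) 1)) := by
  classical
  have hcont : ∀ u : Fin r, contC2 r i u = contC2' r i u ∨
      contC2 r i u ≤ 1 ∧ contC2' r i u ≤ 1 := by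
    intro u
    simp only [contC2, contC2']
    split_ifs <;> omega
  choose e he using fun u => exists_perm_equiv _ _ (hcont u)
  have htwo : ∀ c, i ≤ c → c ≤ r - 1 → ∀ hc : c - 1 < r,
      contC2 r i ⟨c - 1, hc⟩ = 2 ∧ contC2' r i ⟨c - 1, hc⟩ = 2 := by
    intro c h1 h2 hc
    simp only [contC2, contC2']
    split_ifs <;> omega
  refine ⟨Finset.univ.image fun v => (LinearMap.proj v, 0), ?_, ?_⟩
  · intro q hq
    obtain ⟨v, -, rfl⟩ := Finset.mem_image.mp hq
    intro h
    simpa using LinearMap.congr_fun h (fun _ => 1)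
  intro s hs
  have hs0 : ∀ v, s v ≠ 0 := fun v =>
    hs (LinearMap.proj v, 0) (Finset.mem_image_of_mem _ (Finset.mem_univ v))
  simp only [psiC, mul_left_comm _ (1 / 2 : ℂ), Finset.mul_sum]
  rw [← (Equiv.piCongrRight e).sum_comp]
  refine tendsto_finsetSum _ fun π _ => ?_
  refine Tendsto.const_mul _ ?_
  set ρ := Equiv.piCongrRight e π
  have hvar : ∀ x c a, i ≤ c → c ≤ r - 1 → 1 ≤ a → a ≤ 2 →
      tvp r _ π (extendAt r (contC2 r i) _ s x) c a =
      tvp r _ ρ (fun v => s (restrictVar r (contC2 r i) (contC2' r i)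
              (by intro u; simp only [contC2, contC2']; split_ifs <;> omega)
              ⟨⟨r - 1, by omega⟩, ⟨0, by simp only [contC2]; split_ifs <;> omega⟩⟩
              (by simp only [contC2']; split_ifs <;> omega) v)) c a := by
    intro x c a h1 h2 h3 h4
    have hc : c - 1 < r := by omega
    obtain ⟨h5, h6⟩ := htwo c h1 h2 hc
    exact tvp_extendAt _ _ _ π ρ s x c a hc (by omega)
      (he ⟨c - 1, hc⟩ (h5.trans h6.symm) (π _) (a - 1) _ _)
  have hpole : ∀ x, tvp r _ π (extendAt r (contC2 r i)
      ⟨⟨r - 1, by omega⟩, ⟨0, by simp only [contC2]; split_ifs <;> omega⟩⟩ s x) r 1 = x := by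
    intro x
    have hone : contC2 r i ⟨r - 1, by omega⟩ = 1 := by
      simp only [contC2]
      split_ifs <;> omega
    have : Subsingleton (Fin (contC2 r i ⟨r - 1, by omega⟩)) :=
      Fin.subsingleton_iff_le_one.mpr hone.le
    rw [tvp, dif_pos (by omega), dif_pos (by omega), extendAt, dif_pos]
    congr 1
    exact Subsingleton.elim _ _
  have hne : ∀ a, 1 ≤ a → a ≤ 2 →
      tvp r _ ρ (fun v => s (restrictVar r (contC2 r i) (contC2' r i)
              (by intro u; simp only [contC2, contC2']; split_ifs <;> omega)
              ⟨⟨r - 1, by omega⟩, ⟨0, by simp only [contC2]; split_ifs <;> omega⟩⟩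
              (by simp only [contC2']; split_ifs <;> omega) v)) (r - 1) a ≠ 0 := by
    intro a h1 h2
    have h3 := (htwo (r - 1) hir le_rfl (by omega)).2
    rw [tvp, dif_pos (by omega), dif_pos (by omega)]
    exact hs0 _
  have hprod : ∀ x a, 1 ≤ a → a ≤ 2 →
      ∏ u ∈ Finset.Icc i (r - 2), (tvp r _ π (extendAt r (contC2 r i) _ s x) u a -
        tvp r _ π (extendAt r (contC2 r i) _ s x) (u + 1) a) = _ := fun x a h1 h2 =>
    Finset.prod_congr rfl fun u hu => by
      obtain ⟨h3, h4⟩ := Finset.mem_Icc.mp hu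
      rw [hvar x u a h3 (by omega) h1 h2, hvar x (u + 1) a (by omega) (by omega) h1 h2]
  refine (tendsto_mul_inv_simple_pole (hne 1 le_rfl one_le_two) (hne 2 one_le_two le_rfl)
    _ _).congr fun x => ?_
  rw [hpole, hvar x (r - 1) 1 hir le_rfl le_rfl one_le_two,
    hvar x (r - 1) 2 hir le_rfl one_le_two le_rfl, hprod x 1 le_rfl one_le_two,
    hprod x 2 one_le_two le_rfl]
end
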